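/- Let P_Z be a probability distribution on ℝ defining a BMS channel in multiplicative-noise form with capacity C ∈ (0,1). Fix integers 0 ≤ r ≤ m with m ≥ 1 and set N = 2^m. Let X be uniform on the BPSK image of RM(r,m), let Z ∈ ℝ^N have i.i.d. components with law P_Z independent of X, and let Y = X ⊙ Z. If R(r,m) < C, then for every i ∈ {0,…,N−1}, mmse(X_i | Y_{∼i}) ≤ ρ(m)/(C − R(r,m)), where Y_{∼i} denotes the vector Y with the i-th coordinate removed and ρ(m) := (6 ln m + 34)/(5 √m). -/

import Mathlib

open MeasureTheory ProbabilityTheory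

noncomputable section

/-- The binary entropy function (base 2). -/
def hb (p : ℝ) : ℝ := -(p * Real.logb 2 p) - (1 - p) * Real.logb 2 (1 - p)

/-- Conditional expectation `E[X | W]` of `X` given the σ-algebra generated by `W`. -/
def condMean {Ω β E : Type*} [MeasurableSpace Ω] [MeasurableSpace β]
    [NormedAddCommGroup E] [NormedSpace ℝ E] [CompleteSpace E]
    (μ : Measure Ω) (X : Ω → E) (W : Ω → β) : Ω → E :=
  μ[X | MeasurableSpace.comap W inferInstance]

/-- Bit-error probability of the MAP decision rule for `X ∈ {±1}` given `W`. -/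
def BER {Ω β : Type*} [MeasurableSpace Ω] [MeasurableSpace β]
    (μ : Measure Ω) (X : Ω → ℝ) (W : Ω → β) : ℝ :=
  (1 - ∫ ω, |condMean μ X W ω| ∂μ) / 2

/-- Minimum mean squared error of estimating `X` from `W`. -/
def mmse {Ω β : Type*} [MeasurableSpace Ω] [MeasurableSpace β]
    (μ : Measure Ω) (X : Ω → ℝ) (W : Ω → β) : ℝ :=
  ∫ ω, (X ω - condMean μ X W ω) ^ 2 ∂μ

/-- Uniform distribution on `{-1, 1} ⊆ ℝ`. -/
def signMeasure : Measure ℝ := (2 : ENNReal)⁻¹ • (Measure.dirac (-1) + Measure.dirac 1)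

/-- Capacity of the BMS channel (in multiplicative-noise form) with noise law `PZ`:
`C = 1 - E[h_b((1 + E[X_u | Y_u])/2)]` where `X_u` is uniform on `{±1}`, independent of
`Z₀ ~ PZ`, and `Y_u = X_u · Z₀`. -/
def capacity (PZ : Measure ℝ) : ℝ :=
  1 - ∫ p, hb ((1 + condMean (signMeasure.prod PZ)
        (fun q : ℝ × ℝ => q.1) (fun q : ℝ × ℝ => q.1 * q.2) p) / 2) ∂(signMeasure.prod PZ)

/-- Evaluation vector of the multilinear polynomial whose coefficients on monomials
of degree at most `r` are given by `α` (higher-degree coefficients being ignored),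
evaluated at the point `v ∈ 𝔽₂^m` with index `i = Σ_j v_j 2^j`. -/
def RMword (r m : ℕ) (α : Finset (Fin m) → ZMod 2) : Fin (2 ^ m) → ZMod 2 :=
  fun i => ∑ S ∈ Finset.univ.filter (fun S : Finset (Fin m) => S.card ≤ r),
    α S * ∏ j ∈ S, ((((i : ℕ) / 2 ^ (j : ℕ)) % 2 : ℕ) : ZMod 2)

/-- The Reed–Muller code RM(r, m) ⊆ 𝔽₂^{2^m}. -/
def RMcode (r m : ℕ) : Finset (Fin (2 ^ m) → ZMod 2) :=
  Finset.image (RMword r m) Finset.univ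

/-- The rate `R(r,m)` of RM(r,m). -/
def RMrate (r m : ℕ) : ℝ := (2 ^ m : ℝ)⁻¹ * ∑ i ∈ Finset.range (r + 1), (m.choose i : ℝ)

/-- BPSK modulation map `c ↦ ((-1)^{c_0}, …, (-1)^{c_{N-1}})`. -/
def bpsk {N : ℕ} (c : Fin N → ZMod 2) : Fin N → ℝ := fun i => (-1 : ℝ) ^ ((c i).val)

/-- BPSK image of a binary code. -/
def bpskImage {N : ℕ} (C : Finset (Fin N → ZMod 2)) : Finset (Fin N → ℝ) :=
  letI := Classical.decEq (Fin N → ℝ)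
  C.image bpsk

/-- BPSK image of RM(r,m). -/
def bpskRM (r m : ℕ) : Finset (Fin (2 ^ m) → ℝ) := bpskImage (RMcode r m)

/-- Uniform probability measure on a finite set. -/
def uniformOnFinset {α : Type*} [MeasurableSpace α] (s : Finset α) : Measure α :=
  (s.card : ENNReal)⁻¹ • ∑ x ∈ s, Measure.dirac x

/-- `ρ(m) = (6 ln m + 34)/(5 √m)`. -/
def rho (m : ℕ) : ℝ := (6 * Real.log m + 34) / (5 * Real.sqrt m)

/-- Inverse of the binary entropy function restricted to `[0, 1/2]`. -/
def hbInv (u : ℝ) : ℝ := sSup {p : ℝ | p ∈ Set.Icc (0 : ℝ) (1 / 2) ∧ hb p ≤ u}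

/-- `ψ(u) = 1 - (1 - 2 h_b^{-1}(u))²`. -/
def psi (u : ℝ) : ℝ := 1 - (1 - 2 * hbInv u) ^ 2

/-- `Ψ(u) = ∫₀^u ψ(v) dv`. -/
def PsiInt (u : ℝ) : ℝ := ∫ v in (0 : ℝ)..u, psi v

/-- The coefficients `c_k = 1/(ln 2 · 2k (2k-1))`. -/
def ck (k : ℕ) : ℝ := 1 / (Real.log 2 * (2 * k) * (2 * k - 1))

/-- The channel moments `q_k = E[(E[X_u | Y_u])^{2k}]` for uniform input. -/
def qmom (PZ : Measure ℝ) (k : ℕ) : ℝ :=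
  ∫ p, (condMean (signMeasure.prod PZ)
      (fun q : ℝ × ℝ => q.1) (fun q : ℝ × ℝ => q.1 * q.2) p) ^ (2 * k) ∂(signMeasure.prod PZ)

end

namespace RMB

/-! ### Bounded measurable functions -/

/-- Bounded measurable real functions. -/
def BM {α : Type*} [MeasurableSpace α] (F : α → ℝ) : Prop :=
  Measurable F ∧ ∃ C : ℝ, ∀ t, |F t| ≤ C

section bm
variable {α : Type*} [MeasurableSpace α] {F G : α → ℝ}

lemma BM.integrable (h : BM F) (μ : Measure α) [IsFiniteMeasure μ] : Integrable F μ := by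
  obtain ⟨hm, C, hC⟩ := h
  exact Integrable.of_bound hm.aestronglyMeasurable C (Filter.Eventually.of_forall hC)

lemma BM.const (c : ℝ) : BM (fun _ : α => c) := ⟨measurable_const, |c|, fun _ => le_rfl⟩

lemma BM.add (hF : BM F) (hG : BM G) : BM (fun t => F t + G t) := by
  obtain ⟨hm, C, hC⟩ := hF
  obtain ⟨hm', C', hC'⟩ := hG
  exact ⟨hm.add hm', C + C', fun t => (abs_add_le _ _).trans (add_le_add (hC t) (hC' t))⟩

lemma BM.neg (hF : BM F) : BM (fun t => - F t) := by
  obtain ⟨hm, C, hC⟩ := hF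
  exact ⟨hm.neg, C, fun t => by rw [abs_neg]; exact hC t⟩

lemma BM.sub (hF : BM F) (hG : BM G) : BM (fun t => F t - G t) := by
  simpa [sub_eq_add_neg] using hF.add hG.neg

lemma BM.mul (hF : BM F) (hG : BM G) : BM (fun t => F t * G t) := by
  obtain ⟨hm, C, hC⟩ := hF
  obtain ⟨hm', C', hC'⟩ := hG
  refine ⟨hm.mul hm', C * C', fun t => ?_⟩
  rw [abs_mul]
  exact mul_le_mul (hC t) (hC' t) (abs_nonneg _) ((abs_nonneg _).trans (hC t))

lemma BM.pow (hF : BM F) (k : ℕ) : BM (fun t => F t ^ k) := by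
  induction k with
  | zero => simpa using BM.const (α := α) 1
  | succ k ih => simpa [pow_succ] using ih.mul hF

lemma BM.sum {ι : Type*} (s : Finset ι) {F : ι → α → ℝ} (h : ∀ i ∈ s, BM (F i)) :
    BM (fun t => ∑ i ∈ s, F i t) := by
  classical
  induction s using Finset.induction_on with
  | empty => simpa using BM.const (α := α) 0
  | insert a s ha ih =>
    simp only [Finset.sum_insert ha]
    exact (h a (Finset.mem_insert_self _ _)).add
      (ih fun i hi => h i (Finset.mem_insert_of_mem hi))

lemma BM.prod {ι : Type*} (s : Finset ι) {F : ι → α → ℝ} (h : ∀ i ∈ s, BM (F i)) :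
    BM (fun t => ∏ i ∈ s, F i t) := by
  classical
  induction s using Finset.induction_on with
  | empty => simpa using BM.const (α := α) 1
  | insert a s ha ih =>
    simp only [Finset.prod_insert ha]
    exact (h a (Finset.mem_insert_self _ _)).mul
      (ih fun i hi => h i (Finset.mem_insert_of_mem hi))

lemma BM.comp {β : Type*} [MeasurableSpace β] (hF : BM F) {g : β → α} (hg : Measurable g) :
    BM (fun t => F (g t)) := by
  obtain ⟨hm, C, hC⟩ := hF
  exact ⟨hm.comp hg, C, fun t => hC _⟩

/-- Composition with a continuous function. -/
lemma BM.cont (hF : BM F) {ψ : ℝ → ℝ} (hψ : Continuous ψ) : BM (fun t => ψ (F t)) := by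
  obtain ⟨hm, C, hC⟩ := hF
  refine ⟨hψ.measurable.comp hm, ?_⟩
  obtain ⟨C', hC'⟩ := (isCompact_Icc (a := -C) (b := C)).exists_bound_of_continuousOn
    hψ.continuousOn
  exact ⟨C', fun t => hC' _ (abs_le.mp (hC t))⟩

/-- Composition with a continuous function of two variables. -/
lemma BM.cont₂ (hF : BM F) (hG : BM G) {ψ : ℝ → ℝ → ℝ} (hψ : Continuous (Function.uncurry ψ)) :
    BM (fun t => ψ (F t) (G t)) := by
  obtain ⟨hm, C, hC⟩ := hF
  obtain ⟨hm', D, hD⟩ := hG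
  refine ⟨hψ.measurable.comp (hm.prodMk hm'), ?_⟩
  obtain ⟨C', hC'⟩ := ((isCompact_Icc (a := -C) (b := C)).prod
    (isCompact_Icc (a := -D) (b := D))).exists_bound_of_continuousOn hψ.continuousOn
  exact ⟨C', fun t => hC' (F t, G t) ⟨abs_le.mp (hC t), abs_le.mp (hD t)⟩⟩

end bm

/-! ### Variance inequality for product measures -/

/-- Slices. -/
lemma integral_pi_succ {n : ℕ} (p : Measure ℝ) [IsProbabilityMeasure p]
    {F : (Fin (n + 1) → ℝ) → ℝ} (hF : BM F) :
    ∫ t, F t ∂(Measure.pi fun _ => p)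
      = ∫ y, ∫ x, F (Fin.cons y x) ∂(Measure.pi fun _ : Fin n => p) ∂p := by
  have h := (measurePreserving_piFinSuccAbove (fun _ : Fin (n + 1) => p) 0).symm
  rw [← h.integral_comp', integral_prod]
  · simp [MeasurableEquiv.piFinSuccAbove, Fin.insertNthEquiv, Fin.insertNth_zero']
  · exact (hF.comp (MeasurableEquiv.measurable _)).integrable _

lemma BM.slice {n : ℕ} {F : (Fin (n + 1) → ℝ) → ℝ} (hF : BM F) (y : ℝ) :
    BM (fun x : Fin n → ℝ => F (Fin.cons y x)) := by
  refine hF.comp ?_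
  refine measurable_pi_lambda _ fun i => ?_
  refine Fin.cases ?_ (fun j => ?_) i
  · simp
  · simpa using measurable_pi_apply j

lemma measurable_cons2 {n : ℕ} :
    Measurable (fun q : ℝ × (Fin n → ℝ) => (Fin.cons q.1 q.2 : Fin (n + 1) → ℝ)) := by
  refine measurable_pi_lambda _ fun i => ?_
  refine Fin.cases ?_ (fun j => ?_) i
  · simpa using measurable_fst
  · simp only [Fin.cons_succ]
    exact (measurable_pi_apply j).comp measurable_snd

lemma BM.slice_int {n : ℕ} (p : Measure ℝ) [IsProbabilityMeasure p]
    {F : (Fin (n + 1) → ℝ) → ℝ} (hF : BM F) :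
    BM (fun y => ∫ x, F (Fin.cons y x) ∂(Measure.pi fun _ : Fin n => p)) := by
  obtain ⟨hm, C, hC⟩ := hF
  refine ⟨?_, C, fun y => ?_⟩
  · have : StronglyMeasurable (Function.uncurry
        (fun (y : ℝ) (x : Fin n → ℝ) => F (Fin.cons y x))) :=
      (hm.comp measurable_cons2).stronglyMeasurable
    exact this.integral_prod_right.measurable
  · have := norm_integral_le_of_norm_le_const (μ := Measure.pi fun _ : Fin n => p)
      (f := fun x => F (Fin.cons y x)) (C := C) (Filter.Eventually.of_forall fun x => hC _)
    simpa using this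

/-- `g` depends only on the coordinates in `A`. -/
def DepOn {ι : Type*} (A : Set ι) (g : (ι → ℝ) → ℝ) : Prop :=
  ∀ t t' : ι → ℝ, (∀ j ∈ A, t j = t' j) → g t = g t'

theorem variance_ineq {K : Type*} [Fintype K] (c : ℝ) (p : Measure ℝ)
    [IsProbabilityMeasure p] (n : ℕ) :
    ∀ (A : K → Set (Fin n)) (f : (Fin n → ℝ) → ℝ) (g : K → (Fin n → ℝ) → ℝ),
      BM f → (∀ k, BM (g k)) → (∀ k, DepOn (A k) (g k)) →
      (∀ j, ∃ s : Finset K, (∀ k ∈ s, j ∉ A k) ∧ c ≤ s.card) →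
      c * ((∫ t, f t ^ 2 ∂(Measure.pi fun _ => p)) - (∫ t, f t ∂(Measure.pi fun _ => p)) ^ 2)
        ≤ ∑ k, ∫ t, (f t - g k t) ^ 2 ∂(Measure.pi fun _ => p) := by
  classical
  induction n with
  | zero =>
    intro A f g hf hg hdep hcov
    have h1 : ∀ F : (Fin 0 → ℝ) → ℝ, ∫ t, F t ∂(Measure.pi fun _ => p) = F default := by
      intro F
      have : F = fun _ => F default := by
        ext t; rw [Subsingleton.elim t default]
      rw [this]; simp
    simp only [h1]
    rw [sub_self, mul_zero]
    exact Finset.sum_nonneg fun _ _ => sq_nonneg _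
  | succ n ih =>
    intro A f g hf hg hdep hcov
    obtain ⟨s, hsA, hsc⟩ := hcov 0
    -- means of slices
    set P : Measure (Fin n → ℝ) := Measure.pi fun _ => p with hP
    set mf : ℝ → ℝ := fun y => ∫ x, f (Fin.cons y x) ∂P with hmf
    set δ : K → ℝ → ℝ := fun k y => if k ∈ s then ∫ x, (f (Fin.cons y x) - g k (Fin.cons y x)) ∂P
      else 0 with hδ
    have bmf : BM mf := hf.slice_int p
    have bδ : ∀ k, BM (δ k) := by
      intro k
      by_cases hk : k ∈ s
      · simp only [hδ, hk, if_true]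
        exact (hf.sub (hg k)).slice_int p
      · simp only [hδ, hk, if_false]
        exact BM.const 0
    -- slice inequality
    have hslice : ∀ y, c * ((∫ x, f (Fin.cons y x) ^ 2 ∂P) - mf y ^ 2)
        ≤ ∑ k, ((∫ x, (f (Fin.cons y x) - g k (Fin.cons y x)) ^ 2 ∂P) - δ k y ^ 2) := by
      intro y
      have := ih (fun k => {j | j.succ ∈ A k}) (fun x => f (Fin.cons y x))
        (fun k x => g k (Fin.cons y x) + δ k y) (hf.slice y)
        (fun k => ((hg k).slice y).add (BM.const _)) ?_ ?_
      · refine this.trans (Finset.sum_le_sum fun k _ => le_of_eq ?_)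
        by_cases hk : k ∈ s
        · have hd : δ k y = ∫ x, (f (Fin.cons y x) - g k (Fin.cons y x)) ∂P := by simp [hδ, hk]
          have b1 := (hf.slice y).sub ((hg k).slice y)
          have e1 : ∀ x, (f (Fin.cons y x) - (g k (Fin.cons y x) + δ k y)) ^ 2
              = (f (Fin.cons y x) - g k (Fin.cons y x)) ^ 2
                + ((- (2 * δ k y)) * (f (Fin.cons y x) - g k (Fin.cons y x)) + δ k y ^ 2) := by
            intro x; ring
          simp only [e1]
          rw [integral_add ((b1.pow 2).integrable _)
            ((((BM.const (- (2 * δ k y))).mul b1).add (BM.const _)).integrable _),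
            integral_add (((BM.const (- (2 * δ k y))).mul b1).integrable _)
              ((BM.const _).integrable _), integral_const_mul, ← hd]
          simp
          ring
        · simp [hδ, hk]
      · intro k t t' h
        simp only
        congr 1
        refine hdep k _ _ fun j hj => ?_
        refine Fin.cases (fun _ => by simp) (fun i hi => ?_) j hj
        simpa using h i hi
      · intro j
        obtain ⟨s', h1, h2⟩ := hcov j.succ
        exact ⟨s', fun k hk => h1 k hk, h2⟩
    -- the variance of the mean
    have hdel : ∀ k ∈ s, (∫ y, mf y ^ 2 ∂p) - (∫ y, mf y ∂p) ^ 2 ≤ ∫ y, δ k y ^ 2 ∂p := by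
      intro k hk
      set a : ℝ := ∫ x, g k (Fin.cons 0 x) ∂P with ha
      have e : ∀ y, δ k y = mf y - a := by
        intro y
        simp only [hδ, hk, if_true, hmf, ha]
        rw [integral_sub ((hf.slice y).integrable _) (((hg k).slice y).integrable _)]
        congr 1
        refine integral_congr_ae (Filter.Eventually.of_forall fun x => ?_)
        refine hdep k _ _ fun j hj => ?_
        refine Fin.cases (fun h0 => (hsA k hk h0).elim) (fun i _ => by simp) j hj
      have e2 : ∀ y, δ k y ^ 2 = mf y ^ 2 + ((-(2 * a)) * mf y + a ^ 2) := by
        intro y; rw [e]; ring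
      simp only [e2]
      rw [integral_add ((bmf.pow 2).integrable _)
            ((((BM.const (- (2 * a))).mul bmf).add (BM.const _)).integrable _),
            integral_add (((BM.const (- (2 * a))).mul bmf).integrable _)
              ((BM.const _).integrable _), integral_const_mul]
      simp
      nlinarith [sq_nonneg ((∫ y, mf y ∂p) - a)]
    have hvar0 : 0 ≤ (∫ y, mf y ^ 2 ∂p) - (∫ y, mf y ∂p) ^ 2 := by
      have b := (bmf.sub (BM.const (∫ y, mf y ∂p))).pow 2
      have h0 : 0 ≤ ∫ y, (mf y - ∫ y, mf y ∂p) ^ 2 ∂p := integral_nonneg fun y => sq_nonneg _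
      set a := ∫ y, mf y ∂p with ha
      have e2 : ∀ y, (mf y - a) ^ 2 = mf y ^ 2 + ((-(2 * a)) * mf y + a ^ 2) := by
        intro y; ring
      simp only [e2] at h0
      rw [integral_add ((bmf.pow 2).integrable _)
            ((((BM.const (- (2 * a))).mul bmf).add (BM.const _)).integrable _),
            integral_add (((BM.const (- (2 * a))).mul bmf).integrable _)
              ((BM.const _).integrable _), integral_const_mul] at h0
      simp [← ha] at h0
      nlinarith
    -- integrate the slice inequality
    have hintg := integral_mono (μ := p)
      (f := fun y => c * ((∫ x, f (Fin.cons y x) ^ 2 ∂P) - mf y ^ 2))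
      (g := fun y => ∑ k, ((∫ x, (f (Fin.cons y x) - g k (Fin.cons y x)) ^ 2 ∂P) - δ k y ^ 2))
      (((BM.const c).mul (((hf.pow 2).slice_int p).sub (bmf.pow 2))).integrable p)
      ((BM.sum Finset.univ fun k _ =>
        (((hf.sub (hg k)).pow 2).slice_int p).sub ((bδ k).pow 2)).integrable p) hslice
    rw [integral_const_mul, integral_sub (((hf.pow 2).slice_int p).integrable p)
      ((bmf.pow 2).integrable p), integral_finsetSum _ (fun k _ =>
        ((((hf.sub (hg k)).pow 2).slice_int p).sub ((bδ k).pow 2)).integrable p)] at hintg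
    have e3 : ∀ k, ∫ y, ((∫ x, (f (Fin.cons y x) - g k (Fin.cons y x)) ^ 2 ∂P) - δ k y ^ 2) ∂p
        = (∫ t, (f t - g k t) ^ 2 ∂(Measure.pi fun _ => p)) - ∫ y, δ k y ^ 2 ∂p := by
      intro k
      rw [integral_sub ((((hf.sub (hg k)).pow 2).slice_int p).integrable p)
        (((bδ k).pow 2).integrable p), integral_pi_succ p ((hf.sub (hg k)).pow 2)]
    have hsum := Finset.sum_congr (s₁ := Finset.univ) rfl (fun k _ => e3 k)
    have hintg := hintg.trans_eq hsum
    rw [Finset.sum_sub_distrib, ← integral_pi_succ p (hf.pow 2)] at hintg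
    have hf1 : ∫ t, f t ∂(Measure.pi fun _ => p) = ∫ y, mf y ∂p := integral_pi_succ p hf
    have hs1 : c * ((∫ y, mf y ^ 2 ∂p) - (∫ y, mf y ∂p) ^ 2) ≤ ∑ k, ∫ y, δ k y ^ 2 ∂p := by
      calc _ ≤ (s.card : ℝ) * ((∫ y, mf y ^ 2 ∂p) - (∫ y, mf y ∂p) ^ 2) :=
            mul_le_mul_of_nonneg_right hsc hvar0
        _ ≤ ∑ k ∈ s, ∫ y, δ k y ^ 2 ∂p := by
            rw [← nsmul_eq_mul]
            exact Finset.card_nsmul_le_sum _ _ _ hdel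
        _ ≤ _ := Finset.sum_le_sum_of_subset_of_nonneg (Finset.subset_univ _)
            fun k _ _ => integral_nonneg fun y => sq_nonneg _
    rw [hf1]
    linarith

end RMB

namespace RMB

/-- Symmetric measures. -/
def SymM (lam : Measure ℝ) : Prop := Measure.map (fun y => -y) lam = lam

section
variable {N : ℕ} {lam : Measure ℝ} [IsProbabilityMeasure lam]

lemma integral_sgn (hl : SymM lam) {ε : Fin N → ℝ} (hε : ∀ j, ε j = 1 ∨ ε j = -1)
    {F : (Fin N → ℝ) → ℝ} (hF : Measurable F) :
    ∫ t, F (fun j => ε j * t j) ∂(Measure.pi fun _ => lam)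
      = ∫ t, F t ∂(Measure.pi fun _ => lam) := by
  have h : MeasurePreserving (fun (t : Fin N → ℝ) j => ε j * t j)
      (Measure.pi fun _ => lam) (Measure.pi fun _ => lam) := by
    refine measurePreserving_pi (fun _ => lam) (fun _ => lam) (f := fun j y => ε j * y) fun j => ?_
    rcases hε j with h | h
    · simp only [h, one_mul]; exact MeasurePreserving.id _
    · simp only [h, neg_mul, one_mul]; exact ⟨measurable_neg, hl⟩
  conv_rhs => rw [← h.map_eq]
  rw [integral_map h.measurable.aemeasurable hF.aestronglyMeasurable]

lemma integral_perm (σ : Equiv.Perm (Fin N)) (F : (Fin N → ℝ) → ℝ) :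
    ∫ t, F (fun j => t (σ j)) ∂(Measure.pi fun _ => lam)
      = ∫ t, F t ∂(Measure.pi fun _ => lam) := by
  have h := measurePreserving_piCongrLeft (fun _ : Fin N => lam) σ.symm
  rw [← h.integral_comp' F]
  refine integral_congr_ae (Filter.Eventually.of_forall fun t => ?_)
  simp only
  congr 1
  ext j
  have := Equiv.piCongrLeft_apply_apply (fun _ : Fin N => ℝ) σ.symm t (σ j)
  rw [Equiv.symm_apply_apply] at this
  exact this.symm

lemma integral_coord (i : Fin N) {u : ℝ → ℝ}
    {g : (Fin N → ℝ) → ℝ} (hg : BM g) (hd : DepOn {i}ᶜ g) :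
    ∫ t, u (t i) * g t ∂(Measure.pi fun _ => lam)
      = (∫ y, u y ∂lam) * ∫ t, g t ∂(Measure.pi fun _ => lam) := by
  cases N with
  | zero => exact i.elim0
  | succ n =>
    have h := (measurePreserving_piFinSuccAbove (fun _ : Fin (n + 1) => lam) i).symm
    have key : ∀ y x, g ((MeasurableEquiv.piFinSuccAbove (fun _ => ℝ) i).symm (y, x))
        = g ((MeasurableEquiv.piFinSuccAbove (fun _ => ℝ) i).symm (0, x)) := by
      intro y x
      refine hd _ _ fun j hj => ?_
      obtain ⟨k, rfl⟩ := Fin.exists_succAbove_eq (show j ≠ i from hj)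
      simp [MeasurableEquiv.piFinSuccAbove, Fin.insertNthEquiv]
    have mg : BM (fun x : Fin n → ℝ => g ((MeasurableEquiv.piFinSuccAbove
        (fun _ => ℝ) i).symm (0, x))) :=
      hg.comp ((MeasurableEquiv.measurable _).comp (measurable_const.prodMk measurable_id))
    have e1 : ∫ t, g t ∂(Measure.pi fun _ => lam)
        = ∫ x, g ((MeasurableEquiv.piFinSuccAbove (fun _ => ℝ) i).symm (0, x))
          ∂(Measure.pi fun _ : Fin n => lam) := by
      rw [← h.integral_comp', integral_prod]
      · simp only [key]; simp
      · exact (hg.comp (MeasurableEquiv.measurable _)).integrable _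
    rw [e1, ← integral_prod_mul, ← h.integral_comp']
    refine integral_congr_ae (Filter.Eventually.of_forall fun q => ?_)
    obtain ⟨y, x⟩ := q
    simp only
    rw [key]
    congr 1
    simp [MeasurableEquiv.piFinSuccAbove, Fin.insertNthEquiv]

/-- Soft outputs. -/
structure Soft (τ : ℝ → ℝ) : Prop where
  meas : Measurable τ
  odd : ∀ y, τ (-y) = - τ y
  bd : ∀ y, |τ y| ≤ 1

lemma Soft.bm {τ : ℝ → ℝ} (h : Soft τ) : BM τ := ⟨h.meas, 1, h.bd⟩

lemma Soft.zero {τ : ℝ → ℝ} (h : Soft τ) : τ 0 = 0 := by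
  have := h.odd 0
  simp at this; linarith

lemma Soft.sgn {τ : ℝ → ℝ} (h : Soft τ) {e : ℝ} (he : e = 1 ∨ e = -1) (y : ℝ) :
    τ (e * y) = e * τ y := by
  rcases he with rfl | rfl
  · simp
  · simp [h.odd]

lemma Soft.int_zero {τ : ℝ → ℝ} (h : Soft τ) (hl : SymM lam) : ∫ y, τ y ∂lam = 0 := by
  have h1 : ∫ y, τ y ∂lam = ∫ y, τ (-y) ∂lam := by
    conv_lhs => rw [← hl]
    rw [integral_map measurable_neg.aemeasurable h.meas.aestronglyMeasurable]
  simp only [h.odd, integral_neg] at h1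
  linarith

/-- The law of the noise: `(1 + τ) dλ`. -/
noncomputable def tilt (τ : ℝ → ℝ) (lam : Measure ℝ) : Measure ℝ :=
  lam.withDensity (fun y => ENNReal.ofReal (1 + τ y))

lemma integral_tilt {τ : ℝ → ℝ} (h : Soft τ) (F : ℝ → ℝ) :
    ∫ y, F y ∂(tilt τ lam) = ∫ y, (1 + τ y) * F y ∂lam := by
  unfold tilt
  rw [integral_withDensity_eq_integral_toReal_smul
    (by have := h.meas; fun_prop) (Filter.Eventually.of_forall fun _ => ENNReal.ofReal_lt_top)]
  refine integral_congr_ae (Filter.Eventually.of_forall fun y => ?_)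
  simp only [smul_eq_mul]
  rw [ENNReal.toReal_ofReal]
  have := (abs_le.mp (h.bd y)).1; linarith

lemma tilt_prob {τ : ℝ → ℝ} (h : Soft τ) (hl : SymM lam) : IsProbabilityMeasure (tilt τ lam) := by
  constructor
  unfold tilt
  rw [withDensity_apply _ MeasurableSet.univ, Measure.restrict_univ,
    ← ofReal_integral_eq_lintegral_ofReal]
  · rw [integral_add (integrable_const _) (h.bm.integrable _), h.int_zero hl]; simp
  · exact ((BM.const 1).add h.bm).integrable _
  · refine Filter.Eventually.of_forall fun y => ?_
    have := (abs_le.mp (h.bd y)).1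
    simp only [Pi.zero_apply]; linarith

lemma pi_tilt {τ : ℝ → ℝ} (h : Soft τ) (hl : SymM lam) :
    Measure.pi (fun _ : Fin N => tilt τ lam)
      = (Measure.pi fun _ : Fin N => lam).withDensity
        (fun t => ENNReal.ofReal (∏ j, (1 + τ (t j)))) := by
  have hp := tilt_prob h hl
  have hnn : ∀ y, 0 ≤ 1 + τ y := fun y => by
    have := (abs_le.mp (h.bd y)).1; linarith
  refine Measure.pi_eq fun s hs => ?_
  rw [withDensity_apply _ (MeasurableSet.univ_pi hs),
    ← ofReal_integral_eq_lintegral_ofReal]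
  · rw [← integral_indicator (MeasurableSet.univ_pi hs)]
    have e : ∀ t : Fin N → ℝ, (Set.univ.pi s).indicator (fun t => ∏ j, (1 + τ (t j))) t
        = ∏ j, (s j).indicator (fun y => 1 + τ y) (t j) := by
      intro t
      by_cases ht : t ∈ Set.univ.pi s
      · rw [Set.indicator_of_mem ht]
        refine Finset.prod_congr rfl fun j _ => ?_
        rw [Set.indicator_of_mem (ht j trivial)]
      · rw [Set.indicator_of_notMem ht]
        simp only [Set.mem_pi, Set.mem_univ, true_implies, not_forall] at ht
        obtain ⟨j, hj⟩ := ht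
        rw [Finset.prod_eq_zero (Finset.mem_univ j)]
        rw [Set.indicator_of_notMem hj]
    simp only [e]
    rw [integral_fintype_prod_eq_prod (fun j y => (s j).indicator (fun y => 1 + τ y) y),
      ENNReal.ofReal_prod_of_nonneg]
    · refine Finset.prod_congr rfl fun j _ => ?_
      unfold tilt
      rw [withDensity_apply _ (hs j), ← ofReal_integral_eq_lintegral_ofReal,
        integral_indicator (hs j)]
      · exact (((BM.const 1).add h.bm).integrable _)
      · exact Filter.Eventually.of_forall hnn
    · intro j _
      exact integral_nonneg fun y => Set.indicator_nonneg (fun y _ => hnn y) y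
  · exact (BM.prod Finset.univ fun j _ =>
      ((BM.const 1).add (h.bm.comp (measurable_pi_apply j)))).integrable _
  · exact Filter.Eventually.of_forall fun t => Finset.prod_nonneg fun j _ => hnn _

lemma integral_pi_tilt {τ : ℝ → ℝ} (h : Soft τ) (hl : SymM lam) (F : (Fin N → ℝ) → ℝ) :
    ∫ t, F t ∂(Measure.pi (fun _ : Fin N => tilt τ lam))
      = ∫ t, (∏ j, (1 + τ (t j))) * F t ∂(Measure.pi fun _ : Fin N => lam) := by
  rw [pi_tilt h hl, integral_withDensity_eq_integral_toReal_smul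
    ((BM.prod Finset.univ fun j _ =>
      ((BM.const 1).add (h.bm.comp (measurable_pi_apply j)))).1.ennreal_ofReal)
    (Filter.Eventually.of_forall fun _ => ENNReal.ofReal_lt_top)]
  refine integral_congr_ae (Filter.Eventually.of_forall fun y => ?_)
  simp only [smul_eq_mul]
  rw [ENNReal.toReal_ofReal]
  exact Finset.prod_nonneg fun j _ => by have := (abs_le.mp (h.bd (y j))).1; linarith

/-! ### Erasures -/

/-- The erased law. -/
noncomputable def erl (s : ℝ) (lam : Measure ℝ) : Measure ℝ :=
  ENNReal.ofReal s • lam + ENNReal.ofReal (1 - s) • Measure.dirac 0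

lemma erl_prob {s : ℝ} (h0 : 0 ≤ s) (h1 : s ≤ 1) : IsProbabilityMeasure (erl s lam) := by
  constructor
  simp only [erl, Measure.add_apply, Measure.smul_apply, measure_univ, smul_eq_mul, mul_one]
  rw [← ENNReal.ofReal_add h0 (by linarith)]; simp

lemma erl_sym (s : ℝ) (hl : SymM lam) : SymM (erl s lam) := by
  unfold SymM erl
  have hl' : Measure.map Neg.neg lam = lam := hl
  have h2 : Measure.map Neg.neg (Measure.dirac (0 : ℝ)) = Measure.dirac 0 := by
    rw [Measure.map_dirac' measurable_neg, neg_zero]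
  change Measure.map Neg.neg _ = _
  rw [Measure.map_add _ _ measurable_neg, Measure.map_smul, Measure.map_smul, h2, hl']

/-- Weights of subsets. -/
def wt (s : ℝ) (S : Finset (Fin N)) : ℝ := ∏ j, if j ∈ S then s else 1 - s

/-- Masks. -/
def mask (S : Finset (Fin N)) (t : Fin N → ℝ) : Fin N → ℝ := fun j => if j ∈ S then t j else 0

lemma measurable_mask (S : Finset (Fin N)) : Measurable (mask S) := by
  refine measurable_pi_lambda _ fun j => ?_
  by_cases h : j ∈ S
  · simpa [mask, h] using measurable_pi_apply j
  · simp [mask, h]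

lemma wt_nonneg {s : ℝ} (h0 : 0 ≤ s) (h1 : s ≤ 1) (S : Finset (Fin N)) : 0 ≤ wt s S :=
  Finset.prod_nonneg fun j _ => by split_ifs <;> linarith

lemma pi_erl {s : ℝ} (h0 : 0 ≤ s) (h1 : s ≤ 1) :
    Measure.pi (fun _ : Fin N => erl s lam)
      = ∑ S : Finset (Fin N), ENNReal.ofReal (wt s S) •
        (Measure.pi fun _ : Fin N => lam).map (mask S) := by
  classical
  have := erl_prob (lam := lam) h0 h1
  refine Measure.pi_eq fun B hB => ?_
  rw [Measure.finsetSum_apply]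
  simp only [erl, Measure.add_apply, Measure.smul_apply, smul_eq_mul]
  rw [Finset.prod_add]
  rw [Finset.powerset_univ]
  refine Finset.sum_congr rfl fun S _ => ?_
  rw [Measure.map_apply (measurable_mask S) (MeasurableSet.univ_pi hB)]
  have e : Set.preimage (mask S) (Set.univ.pi B) = Set.univ.pi (fun j => if j ∈ S then B j else
      {_y : ℝ | (0 : ℝ) ∈ B j}) := by
    ext t
    simp only [Set.mem_preimage, Set.mem_pi, Set.mem_univ, true_implies, mask]
    refine forall_congr' fun j => ?_
    split_ifs <;> simp
  rw [e, Measure.pi_pi, wt, ENNReal.ofReal_prod_of_nonneg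
    (fun j _ => by split_ifs <;> linarith), ← Finset.prod_mul_distrib,
    ← Finset.prod_mul_prod_compl S]
  congr 1
  · refine Finset.prod_congr rfl fun j hj => ?_
    simp [hj]
  · refine Finset.prod_congr (by ext; simp) fun j hj => ?_
    have hj' : j ∉ S := by simpa using hj
    simp only [hj', if_false]
    congr 1
    rw [Measure.dirac_apply' _ (hB j)]
    by_cases h : (0 : ℝ) ∈ B j <;> simp [h]

lemma integral_erl {s : ℝ} (h0 : 0 ≤ s) (h1 : s ≤ 1) {F : (Fin N → ℝ) → ℝ} (hF : BM F) :
    ∫ t, F t ∂(Measure.pi (fun _ : Fin N => erl s lam))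
      = ∑ S : Finset (Fin N), wt s S * ∫ t, F (mask S t) ∂(Measure.pi fun _ : Fin N => lam) := by
  have hfin : ∀ S : Finset (Fin N), IsFiniteMeasure (ENNReal.ofReal (wt s S) •
        (Measure.pi fun _ : Fin N => lam).map (mask S)) := fun S => by
    have : IsProbabilityMeasure ((Measure.pi fun _ : Fin N => lam).map (mask S)) :=
      Measure.isProbabilityMeasure_map (measurable_mask S).aemeasurable
    exact Measure.smul_finite _ ENNReal.ofReal_ne_top
  rw [pi_erl h0 h1, integral_finsetSum_measure (fun S _ => hF.integrable _)]
  refine Finset.sum_congr rfl fun S _ => ?_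
  rw [integral_smul_measure, integral_map (measurable_mask S).aemeasurable
    hF.1.aestronglyMeasurable, ENNReal.toReal_ofReal (wt_nonneg h0 h1 S), smul_eq_mul]

lemma sum_wt {s : ℝ} : ∑ S : Finset (Fin N), wt s S = 1 := by
  classical
  have := Finset.prod_add (fun _ : Fin N => s) (fun _ => 1 - s) Finset.univ
  simp only [add_sub_cancel, Finset.prod_const_one, Finset.powerset_univ] at this
  rw [this]
  refine Finset.sum_congr rfl fun S _ => ?_
  rw [wt, ← Finset.prod_mul_prod_compl S]
  congr 1
  · exact Finset.prod_congr rfl fun j hj => by simp [hj]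
  · exact Finset.prod_congr (by ext; simp) fun j hj => by simp at hj; simp [hj]

end

end RMB

namespace RMB

/-! ### One-dimensional inequalities -/

/-- `(1+x) log (1+x)` -/
noncomputable def eta (x : ℝ) : ℝ := (1 + x) * Real.log (1 + x)

lemma eta_cont : Continuous eta :=
  Real.continuous_mul_log.comp (continuous_const.add continuous_id)

lemma eta_le {x : ℝ} (hx : -1 ≤ x) : eta x ≤ x + x ^ 2 := by
  unfold eta
  rcases hx.eq_or_lt with rfl | h
  · norm_num
  · have h1 : 0 < 1 + x := by linarith
    have := Real.log_le_sub_one_of_pos h1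
    nlinarith

lemma le_eta {x : ℝ} (hx : -1 ≤ x) : x ≤ eta x := by
  unfold eta
  rcases hx.eq_or_lt with rfl | h
  · norm_num
  · have h1 : 0 < 1 + x := by linarith
    have := Real.one_sub_inv_le_log_of_pos h1
    have h2 := mul_le_mul_of_nonneg_left this h1.le
    rw [mul_sub, mul_inv_cancel₀ h1.ne'] at h2
    linarith

lemma eta_convex : ConvexOn ℝ (Set.Icc (-1 : ℝ) 1) (fun x => eta x - x ^ 2 / 4) := by
  have hintg : interior (Set.Icc (-1 : ℝ) 1) = Set.Ioo (-1) 1 := interior_Icc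
  have hd : ∀ x ∈ Set.Ioo (-1 : ℝ) 1, HasDerivAt (fun x => eta x - x ^ 2 / 4)
      (Real.log (1 + x) + 1 - x / 2) x := by
    intro x hx
    have h1 : (1 : ℝ) + x ≠ 0 := by have := hx.1; linarith
    have ha : HasDerivAt (fun x : ℝ => 1 + x) 1 x := (hasDerivAt_id x).const_add 1
    have := (ha.mul (ha.log h1)).sub (((hasDerivAt_id x).pow 2).div_const 4)
    refine this.congr_deriv ?_
    simp
    field_simp
    ring
  refine convexOn_of_deriv2_nonneg (convex_Icc _ _) ?_ ?_ ?_ ?_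
  · exact (eta_cont.sub (by fun_prop)).continuousOn
  · rw [hintg]
    exact fun x hx => (hd x hx).differentiableAt.differentiableWithinAt
  · rw [hintg]
    intro x hx
    have h1 : (1 : ℝ) + x ≠ 0 := by have := hx.1; linarith
    have : DifferentiableAt ℝ (fun x => Real.log (1 + x) + 1 - x / 2) x := by fun_prop (disch := assumption)
    refine (this.congr_of_eventuallyEq ?_).differentiableWithinAt
    filter_upwards [isOpen_Ioo.mem_nhds hx] with y hy using (hd y hy).deriv
  · rw [hintg]
    intro x hx
    have h1 : (0 : ℝ) < 1 + x := by have := hx.1; linarith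
    have e : deriv^[2] (fun x => eta x - x ^ 2 / 4) x
        = deriv (fun x => Real.log (1 + x) + 1 - x / 2) x := by
      simp only [Function.iterate_succ, Function.iterate_zero, Function.comp, id]
      refine Filter.EventuallyEq.deriv_eq ?_
      filter_upwards [isOpen_Ioo.mem_nhds hx] with y hy using (hd y hy).deriv
    have ha : HasDerivAt (fun x : ℝ => 1 + x) 1 x := (hasDerivAt_id x).const_add 1
    have hd2 : HasDerivAt (fun x => Real.log (1 + x) + 1 - x / 2) (1 / (1 + x) - 1 / 2) x :=
      ((ha.log h1.ne').add_const 1).sub ((hasDerivAt_id x).div_const 2)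
    rw [e, hd2.deriv, sub_nonneg]
    exact one_div_le_one_div_of_le h1 (by have := hx.2; linarith)

/-- The function used for comparing. -/
noncomputable def psi1 (u f : ℝ) : ℝ := eta (u * f) - (u * f) ^ 2 / 4

lemma psi1_cont : Continuous (Function.uncurry psi1) := by
  unfold psi1
  have := eta_cont
  simp only [Function.uncurry_def]
  fun_prop

lemma psi1_convex {u : ℝ} (hu : |u| ≤ 1) : ConvexOn ℝ (Set.Icc (-1 : ℝ) 1) (psi1 u) := by
  refine ⟨convex_Icc _ _, fun x hx y hy a b ha hb hab => ?_⟩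
  have hm : ∀ z ∈ Set.Icc (-1 : ℝ) 1, u * z ∈ Set.Icc (-1 : ℝ) 1 := by
    intro z hz
    rw [Set.mem_Icc, ← abs_le] at hz ⊢
    rw [abs_mul]
    exact mul_le_one₀ hu (abs_nonneg _) hz
  have := eta_convex.2 (hm x hx) (hm y hy) ha hb hab
  simp only [smul_eq_mul] at this ⊢
  unfold psi1
  rw [show u * (a * x + b * y) = a * (u * x) + b * (u * y) by ring]
  exact this

/-- Convexity of the perspective at midpoints. -/
lemma persp {ψ : ℝ → ℝ} (hψ : ConvexOn ℝ (Set.Icc (-1 : ℝ) 1) ψ) {a b n n' : ℝ}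
    (ha : |n| ≤ a) (hb : |n'| ≤ b) :
    (a + b) / 2 * ψ (((n + n') / 2) / ((a + b) / 2)) ≤ (a * ψ (n / a) + b * ψ (n' / b)) / 2 := by
  have ha0 : 0 ≤ a := (abs_nonneg _).trans ha
  have hb0 : 0 ≤ b := (abs_nonneg _).trans hb
  rcases ha0.eq_or_lt with rfl | ha1
  · have : n = 0 := abs_nonpos_iff.mp ha
    subst this
    simp only [zero_add, zero_mul]
    rw [div_div_div_cancel_right₀ (by norm_num)]
    linarith
  rcases hb0.eq_or_lt with rfl | hb1
  · have : n' = 0 := abs_nonpos_iff.mp hb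
    subst this
    simp only [add_zero, zero_mul]
    rw [div_div_div_cancel_right₀ (by norm_num)]
    linarith
  have hab : 0 < a + b := by linarith
  have h1 : n / a ∈ Set.Icc (-1 : ℝ) 1 := by
    rw [Set.mem_Icc, ← abs_le, abs_div, abs_of_pos ha1]; exact div_le_one_of_le₀ ha ha0
  have h2 : n' / b ∈ Set.Icc (-1 : ℝ) 1 := by
    rw [Set.mem_Icc, ← abs_le, abs_div, abs_of_pos hb1]; exact div_le_one_of_le₀ hb hb0
  have := hψ.2 h1 h2 (show (0:ℝ) ≤ a / (a + b) by positivity)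
    (show (0:ℝ) ≤ b / (a + b) by positivity) (by field_simp)
  simp only [smul_eq_mul] at this
  have e : a / (a + b) * (n / a) + b / (a + b) * (n' / b) = ((n + n') / 2) / ((a + b) / 2) := by
    field_simp
  rw [e] at this
  calc _ ≤ (a + b) / 2 * (a / (a + b) * ψ (n / a) + b / (a + b) * ψ (n' / b)) :=
        mul_le_mul_of_nonneg_left this (by positivity)
    _ = _ := by field_simp

/-! ### Codes -/

/-- Sign groups. -/
structure SG {N : ℕ} (𝒞 : Finset (Fin N → ℝ)) : Prop where
  pm : ∀ x ∈ 𝒞, ∀ i, x i = 1 ∨ x i = -1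
  mul : ∀ x ∈ 𝒞, ∀ y ∈ 𝒞, (fun i => x i * y i) ∈ 𝒞
  one : (fun _ => 1) ∈ 𝒞

section
variable {N : ℕ} {τ : ℝ → ℝ} {𝒞 : Finset (Fin N → ℝ)}

/-- Weighted likelihood average. -/
noncomputable def Wd (τ : ℝ → ℝ) (𝒞 : Finset (Fin N → ℝ)) (w : (Fin N → ℝ) → ℝ)
    (S : Finset (Fin N)) (t : Fin N → ℝ) : ℝ :=
  (𝒞.card : ℝ)⁻¹ * ∑ x ∈ 𝒞, w x * ∏ j ∈ S, (1 + x j * τ (t j))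

/-- Likelihood. -/
noncomputable def Dd (τ : ℝ → ℝ) (𝒞 : Finset (Fin N → ℝ)) (S : Finset (Fin N))
    (t : Fin N → ℝ) : ℝ := Wd τ 𝒞 (fun _ => 1) S t

/-- Signed likelihood. -/
noncomputable def Nd (τ : ℝ → ℝ) (𝒞 : Finset (Fin N → ℝ)) (i : Fin N) (S : Finset (Fin N))
    (t : Fin N → ℝ) : ℝ := Wd τ 𝒞 (fun x => x i) S t

/-- Posterior mean. -/
noncomputable def fd (τ : ℝ → ℝ) (𝒞 : Finset (Fin N → ℝ)) (i : Fin N) (S : Finset (Fin N))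
    (t : Fin N → ℝ) : ℝ := Nd τ 𝒞 i S t / Dd τ 𝒞 S t

lemma Wd_bm (hτ : Soft τ) (w : (Fin N → ℝ) → ℝ) (S : Finset (Fin N)) : BM (Wd τ 𝒞 w S) := by
  unfold Wd
  exact (BM.const _).mul (BM.sum _ fun x _ => (BM.const _).mul (BM.prod _ fun j _ =>
    (BM.const 1).add ((BM.const _).mul (hτ.bm.comp (measurable_pi_apply j)))))

lemma Wd_dep (w : (Fin N → ℝ) → ℝ) (S : Finset (Fin N)) : DepOn (S : Set (Fin N)) (Wd τ 𝒞 w S) := by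
  intro t t' h
  unfold Wd
  congr 1
  refine Finset.sum_congr rfl fun x _ => ?_
  congr 1
  exact Finset.prod_congr rfl fun j hj => by rw [h j hj]

lemma fd_dep (i : Fin N) (S : Finset (Fin N)) : DepOn (S : Set (Fin N)) (fd τ 𝒞 i S) := by
  intro t t' h
  unfold fd Nd Dd
  rw [Wd_dep _ S t t' h, Wd_dep _ S t t' h]

lemma DepOn.mono {ι : Type*} {A B : Set ι} {g : (ι → ℝ) → ℝ} (h : DepOn A g) (hAB : A ⊆ B) :
    DepOn B g := fun t t' ht => h t t' fun j hj => ht j (hAB hj)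

lemma factor_nonneg (hτ : Soft τ) (hC : SG 𝒞) {x} (hx : x ∈ 𝒞) (j : Fin N) (y : ℝ) :
    0 ≤ 1 + x j * τ y := by
  have := abs_le.mp (hτ.bd y)
  rcases hC.pm x hx j with h | h <;> rw [h] <;> linarith [this.1, this.2]

lemma Dd_nonneg (hτ : Soft τ) (hC : SG 𝒞) (S : Finset (Fin N)) (t) : 0 ≤ Dd τ 𝒞 S t := by
  unfold Dd Wd
  refine mul_nonneg (by positivity) (Finset.sum_nonneg fun x hx => ?_)
  rw [one_mul]
  exact Finset.prod_nonneg fun j _ => factor_nonneg hτ hC hx j _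

lemma Nd_le (hτ : Soft τ) (hC : SG 𝒞) (i : Fin N) (S : Finset (Fin N)) (t) :
    |Nd τ 𝒞 i S t| ≤ Dd τ 𝒞 S t := by
  unfold Nd Dd Wd
  rw [abs_mul, abs_of_nonneg (by positivity : (0 : ℝ) ≤ (𝒞.card : ℝ)⁻¹)]
  refine mul_le_mul_of_nonneg_left ?_ (by positivity)
  refine (Finset.abs_sum_le_sum_abs _ _).trans (Finset.sum_le_sum fun x hx => ?_)
  rw [abs_mul, abs_of_nonneg (Finset.prod_nonneg fun j _ => factor_nonneg hτ hC hx j _)]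
  rcases hC.pm x hx i with h | h <;> simp [h]

lemma fd_le (hτ : Soft τ) (hC : SG 𝒞) (i : Fin N) (S : Finset (Fin N)) (t) :
    |fd τ 𝒞 i S t| ≤ 1 := by
  unfold fd
  rw [abs_div, abs_of_nonneg (Dd_nonneg hτ hC S t)]
  exact div_le_one_of_le₀ (Nd_le hτ hC i S t) (Dd_nonneg hτ hC S t)

lemma Dd_bm (hτ : Soft τ) (S : Finset (Fin N)) : BM (Dd τ 𝒞 S) := Wd_bm hτ _ S
lemma Nd_bm (hτ : Soft τ) (i) (S : Finset (Fin N)) : BM (Nd τ 𝒞 i S) := Wd_bm hτ _ S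
lemma fd_bm (hτ : Soft τ) (hC : SG 𝒞) (i) (S : Finset (Fin N)) : BM (fd τ 𝒞 i S) :=
  ⟨(Nd_bm hτ i S).1.div (Dd_bm hτ S).1, 1, fd_le hτ hC i S⟩

lemma fd_mul (hτ : Soft τ) (hC : SG 𝒞) (i : Fin N) (S : Finset (Fin N)) (t) :
    Dd τ 𝒞 S t * fd τ 𝒞 i S t = Nd τ 𝒞 i S t := by
  unfold fd
  by_cases h : Dd τ 𝒞 S t = 0
  · have := Nd_le hτ hC i S t
    rw [h] at this ⊢
    rw [abs_nonpos_iff.mp this]; simp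
  · field_simp

lemma Wd_insert (w : (Fin N → ℝ) → ℝ) {S : Finset (Fin N)} {j : Fin N} (hj : j ∉ S) (t) :
    Wd τ 𝒞 w (insert j S) t = Wd τ 𝒞 w S t + τ (t j) * Wd τ 𝒞 (fun x => w x * x j) S t := by
  simp only [Wd]
  rw [mul_left_comm, ← mul_add]
  congr 1
  rw [Finset.mul_sum, ← Finset.sum_add_distrib]
  refine Finset.sum_congr rfl fun x _ => ?_
  rw [Finset.prod_insert hj]; ring

lemma Dd_insert {S : Finset (Fin N)} {j : Fin N} (hj : j ∉ S) (t) :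
    Dd τ 𝒞 (insert j S) t = Dd τ 𝒞 S t + τ (t j) * Nd τ 𝒞 j S t := by
  unfold Dd Nd
  rw [Wd_insert _ hj]; simp

/-- Flip of coordinate `j`. -/
def fl (j : Fin N) (t : Fin N → ℝ) : Fin N → ℝ := fun k => (if k = j then -1 else 1) * t k

lemma integral_fl {lam : Measure ℝ} [IsProbabilityMeasure lam] (hl : SymM lam) (j : Fin N)
    {F : (Fin N → ℝ) → ℝ} (hF : Measurable F) :
    ∫ t, F (fl j t) ∂(Measure.pi fun _ => lam) = ∫ t, F t ∂(Measure.pi fun _ => lam) :=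
  integral_sgn hl (ε := fun k => if k = j then -1 else 1)
    (fun k => by by_cases h : k = j <;> simp [h]) hF

lemma measurable_fl (j : Fin N) : Measurable (fl j) :=
  measurable_pi_lambda _ fun k => (measurable_pi_apply k).const_mul _

lemma fl_dep {j : Fin N} {g : (Fin N → ℝ) → ℝ} (hg : DepOn {j}ᶜ g) (t) : g (fl j t) = g t :=
  hg _ _ fun k hk => by
    have : k ≠ j := hk
    simp [fl, this]

lemma Wd_dep' (w : (Fin N → ℝ) → ℝ) {S : Finset (Fin N)} {j} (hj : j ∉ S) :
    DepOn {j}ᶜ (Wd τ 𝒞 w S) :=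
  (Wd_dep w S).mono fun k hk (h : k = j) => hj (h ▸ hk)

lemma fd_dep' (i) {S : Finset (Fin N)} {j} (hj : j ∉ S) :
    DepOn {j}ᶜ (fd τ 𝒞 i S) :=
  (fd_dep i S).mono fun k hk (h : k = j) => hj (h ▸ hk)

lemma tau_fl (hτ : Soft τ) (j : Fin N) (t) : τ (fl j t j) = - τ (t j) := by
  simp [fl, hτ.odd]

lemma Wd_flip (hτ : Soft τ) (w : (Fin N → ℝ) → ℝ) {S : Finset (Fin N)} {j : Fin N} (hj : j ∉ S)
    (t) : Wd τ 𝒞 w S t = (Wd τ 𝒞 w (insert j S) t + Wd τ 𝒞 w (insert j S) (fl j t)) / 2 := by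
  rw [Wd_insert _ hj, Wd_insert _ hj, tau_fl hτ, fl_dep (Wd_dep' _ hj), fl_dep (Wd_dep' _ hj)]
  ring

section integrals
variable {lam : Measure ℝ} [IsProbabilityMeasure lam]

lemma marg_step (hτ : Soft τ) (hl : SymM lam) (w : (Fin N → ℝ) → ℝ) {S : Finset (Fin N)}
    {j : Fin N} (hj : j ∉ S) {g : (Fin N → ℝ) → ℝ} (hg : BM g) (hd : DepOn {j}ᶜ g) :
    ∫ t, Wd τ 𝒞 w (insert j S) t * g t ∂(Measure.pi fun _ => lam)
      = ∫ t, Wd τ 𝒞 w S t * g t ∂(Measure.pi fun _ => lam) := by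
  have b := (Wd_bm (𝒞 := 𝒞) hτ w (insert j S)).mul hg
  have h1 := integral_fl hl j b.1
  have e : ∀ t, Wd τ 𝒞 w S t * g t = (Wd τ 𝒞 w (insert j S) t * g t
      + Wd τ 𝒞 w (insert j S) (fl j t) * g (fl j t)) / 2 := by
    intro t; rw [Wd_flip hτ w hj, fl_dep hd]; ring
  simp only [e]
  rw [integral_div, integral_add (b.integrable _) ((b.comp (measurable_fl j)).integrable _), h1]
  ring

lemma marg (hτ : Soft τ) (hl : SymM lam) (w : (Fin N → ℝ) → ℝ) {A T : Finset (Fin N)}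
    (hAT : A ⊆ T) {g : (Fin N → ℝ) → ℝ} (hg : BM g) (hd : DepOn (A : Set (Fin N)) g) :
    ∫ t, Wd τ 𝒞 w T t * g t ∂(Measure.pi fun _ => lam)
      = ∫ t, Wd τ 𝒞 w A t * g t ∂(Measure.pi fun _ => lam) := by
  classical
  induction T using Finset.induction_on generalizing A with
  | empty => rw [Finset.subset_empty.mp hAT]
  | insert j T hj ih =>
    by_cases hjA : j ∈ A
    · -- remove j from A : work with equality if A = insert j T, otherwise pick another element
      have key : ∀ B : Finset (Fin N), A ⊆ B → 
          ∫ t, Wd τ 𝒞 w B t * g t ∂(Measure.pi fun _ => lam)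
            = ∫ t, Wd τ 𝒞 w A t * g t ∂(Measure.pi fun _ => lam) := by
        intro B hB
        obtain ⟨U, rfl⟩ : ∃ U, A ∪ U = B := ⟨B, Finset.union_eq_right.mpr hB⟩
        clear hB
        induction U using Finset.induction_on with
        | empty => simp
        | insert k U hk ihU =>
          by_cases hkA : k ∈ A ∪ U
          · rw [Finset.union_insert, Finset.insert_eq_of_mem hkA, ihU]
          · rw [Finset.union_insert, marg_step hτ hl w hkA hg, ihU]
            refine hd.mono fun l hl' (h : l = k) => hkA ?_
            rw [← h]; exact Finset.mem_union_left _ hl'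
      exact key _ hAT
    · have hAT' : A ⊆ T := (Finset.subset_insert_iff_of_notMem hjA).mp hAT
      rw [marg_step hτ hl w hj hg, ih hAT' hd]
      exact hd.mono fun l hl' (h : l = j) => hjA (h ▸ hl')

/-- Convex functionals. -/
noncomputable def Jf (τ : ℝ → ℝ) (𝒞 : Finset (Fin N → ℝ)) (lam : Measure ℝ) (i : Fin N)
    (ψ : ℝ → ℝ → ℝ) (S : Finset (Fin N)) : ℝ :=
  ∫ t, Dd τ 𝒞 S t * ψ (τ (t i)) (fd τ 𝒞 i S t) ∂(Measure.pi fun _ => lam)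

lemma J_bm (hτ : Soft τ) (hC : SG 𝒞) (i : Fin N) {ψ : ℝ → ℝ → ℝ}
    (hψ : Continuous (Function.uncurry ψ)) (S : Finset (Fin N)) :
    BM (fun t => Dd τ 𝒞 S t * ψ (τ (t i)) (fd τ 𝒞 i S t)) :=
  (Dd_bm hτ S).mul ((hτ.bm.comp (measurable_pi_apply i)).cont₂ (fd_bm hτ hC i S) hψ)

lemma J_step (hτ : Soft τ) (hC : SG 𝒞) (hl : SymM lam) {i : Fin N} {ψ : ℝ → ℝ → ℝ}
    (hψ : Continuous (Function.uncurry ψ))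
    (hconv : ∀ u, |u| ≤ 1 → ConvexOn ℝ (Set.Icc (-1 : ℝ) 1) (ψ u))
    {S : Finset (Fin N)} {j : Fin N} (hj : j ∉ S) (hji : j ≠ i) :
    Jf τ 𝒞 lam i ψ S ≤ Jf τ 𝒞 lam i ψ (insert j S) := by
  unfold Jf
  have b := J_bm hτ hC i hψ (insert j S)
  have h1 := integral_fl hl j b.1
  calc _ ≤ ∫ t, (Dd τ 𝒞 (insert j S) t * ψ (τ (t i)) (fd τ 𝒞 i (insert j S) t)
        + Dd τ 𝒞 (insert j S) (fl j t) * ψ (τ (fl j t i)) (fd τ 𝒞 i (insert j S) (fl j t))) / 2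
          ∂(Measure.pi fun _ => lam) := by
        refine integral_mono ((J_bm hτ hC i hψ S).integrable _) ?_ fun t => ?_
        · exact ((b.integrable _).add ((b.comp (measurable_fl j)).integrable _)).div_const _
        · have hti : fl j t i = t i := by simp [fl, hji.symm]
          have := persp (hconv (τ (t i)) (hτ.bd _)) (Nd_le hτ hC i (insert j S) t)
            (Nd_le hτ hC i (insert j S) (fl j t))
          simp only [hti]
          unfold fd
          have e1 : Dd τ 𝒞 S t = _ := Wd_flip hτ _ hj t
          have e2 : Nd τ 𝒞 i S t = _ := Wd_flip hτ _ hj t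
          rw [e1, e2]
          exact this
    _ = _ := by
        rw [integral_div, integral_add (b.integrable _) ((b.comp (measurable_fl j)).integrable _),
          h1]
        ring

lemma J_mono (hτ : Soft τ) (hC : SG 𝒞) (hl : SymM lam) {i : Fin N} {ψ : ℝ → ℝ → ℝ}
    (hψ : Continuous (Function.uncurry ψ))
    (hconv : ∀ u, |u| ≤ 1 → ConvexOn ℝ (Set.Icc (-1 : ℝ) 1) (ψ u))
    {A S : Finset (Fin N)} (hAS : A ⊆ S) (hi : i ∉ S) :
    Jf τ 𝒞 lam i ψ A ≤ Jf τ 𝒞 lam i ψ S := by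
  classical
  obtain ⟨U, hU⟩ : ∃ U, A ∪ U = S := ⟨S, Finset.union_eq_right.mpr hAS⟩
  rw [← hU]
  have hiU : i ∉ U := fun h => hi (hU ▸ Finset.mem_union_right _ h)
  clear hU hAS
  induction U using Finset.induction_on with
  | empty => simp
  | insert k U hk ihU =>
    have h1 := ihU fun h => hiU (Finset.mem_insert_of_mem h)
    rw [Finset.union_insert]
    by_cases hkA : k ∈ A ∪ U
    · rwa [Finset.insert_eq_of_mem hkA]
    · exact h1.trans (J_step hτ hC hl hψ hconv hkA fun h => hiU (h ▸ Finset.mem_insert_self _ _))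

end integrals
end

end RMB

namespace RMB

section
variable {N : ℕ} {τ : ℝ → ℝ} {𝒞 : Finset (Fin N → ℝ)}

/-- Action of signs. -/
def act (x t : Fin N → ℝ) : Fin N → ℝ := fun j => x j * t j

lemma measurable_act (x : Fin N → ℝ) : Measurable (act x) :=
  measurable_pi_lambda _ fun k => (measurable_pi_apply k).const_mul _

lemma SG.sq (hC : SG 𝒞) {x} (hx : x ∈ 𝒞) (i : Fin N) : x i * x i = 1 := by
  rcases hC.pm x hx i with h | h <;> simp [h]

lemma SG.sum_mul (hC : SG 𝒞) {x} (hx : x ∈ 𝒞) (F : (Fin N → ℝ) → ℝ) :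
    ∑ y ∈ 𝒞, F y = ∑ y ∈ 𝒞, F (act x y) := by
  have hinv : ∀ y, act x (act x y) = y := fun y => by
    ext j; simp only [act]; rw [← mul_assoc, hC.sq hx, one_mul]
  refine Finset.sum_nbij' (act x) (act x) (fun y hy => hC.mul x hx y hy)
    (fun y hy => hC.mul x hx y hy) (fun y _ => hinv y) (fun y _ => hinv y) fun y _ => ?_
  rw [hinv]

lemma Wd_act (hτ : Soft τ) (hC : SG 𝒞) {x} (hx : x ∈ 𝒞) (w : (Fin N → ℝ) → ℝ)
    (S : Finset (Fin N)) (t) :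
    Wd τ 𝒞 w S (act x t) = Wd τ 𝒞 (fun y => w (act x y)) S t := by
  unfold Wd
  rw [hC.sum_mul hx]
  congr 1
  refine Finset.sum_congr rfl fun y _ => ?_
  congr 1
  refine Finset.prod_congr rfl fun j _ => ?_
  simp only [act]
  rw [hτ.sgn (hC.pm x hx j)]
  linear_combination (y j * τ (t j)) * hC.sq hx j

lemma Dd_act (hτ : Soft τ) (hC : SG 𝒞) {x} (hx : x ∈ 𝒞) (S : Finset (Fin N)) (t) :
    Dd τ 𝒞 S (act x t) = Dd τ 𝒞 S t := Wd_act hτ hC hx _ S t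

lemma Nd_act (hτ : Soft τ) (hC : SG 𝒞) {x} (hx : x ∈ 𝒞) (i) (S : Finset (Fin N)) (t) :
    Nd τ 𝒞 i S (act x t) = x i * Nd τ 𝒞 i S t := by
  unfold Nd
  rw [Wd_act hτ hC hx]
  unfold Wd
  rw [mul_left_comm]
  congr 1
  rw [Finset.mul_sum]
  exact Finset.sum_congr rfl fun y _ => by simp only [act]; ring

lemma fd_act (hτ : Soft τ) (hC : SG 𝒞) {x} (hx : x ∈ 𝒞) (i) (S : Finset (Fin N)) (t) :
    fd τ 𝒞 i S (act x t) = x i * fd τ 𝒞 i S t := by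
  unfold fd
  rw [Nd_act hτ hC hx, Dd_act hτ hC hx]; ring

section integrals
variable {lam : Measure ℝ} [IsProbabilityMeasure lam]

lemma SG.card_pos (hC : SG 𝒞) : (0 : ℝ) < 𝒞.card := by
  exact_mod_cast Finset.card_pos.mpr ⟨_, hC.one⟩

lemma avg (hτ : Soft τ) (hC : SG 𝒞) (hl : SymM lam) (v : (Fin N → ℝ) → ℝ)
    {F : (Fin N → ℝ) → ℝ} (hF : BM F) (hv : ∀ x ∈ 𝒞, ∀ t, F (act x t) = v x * F t) :
    ∫ t, (∏ j, (1 + τ (t j))) * F t ∂(Measure.pi fun _ => lam)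
      = ∫ t, Wd τ 𝒞 v Finset.univ t * F t ∂(Measure.pi fun _ => lam) := by
  have bp : ∀ x : Fin N → ℝ, BM (fun t : Fin N → ℝ => ∏ j, (1 + x j * τ (t j))) := fun x =>
    BM.prod _ fun j _ => (BM.const 1).add ((BM.const _).mul (hτ.bm.comp (measurable_pi_apply j)))
  have b1 : BM (fun t : Fin N → ℝ => (∏ j, (1 + τ (t j))) * F t) := by
    have := (bp fun _ => 1).mul hF
    simpa only [one_mul] using this
  have e : ∀ t, Wd τ 𝒞 v Finset.univ t * F t
      = ∑ x ∈ 𝒞, (𝒞.card : ℝ)⁻¹ * ((∏ j, (1 + x j * τ (t j))) * F (act x t)) := by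
    intro t
    unfold Wd
    rw [mul_assoc, Finset.sum_mul, Finset.mul_sum]
    refine Finset.sum_congr rfl fun x hx => ?_
    rw [hv x hx]; ring
  simp only [e]
  rw [integral_finset_sum]
  · have : ∀ x ∈ 𝒞, ∫ t, (𝒞.card : ℝ)⁻¹ * ((∏ j, (1 + x j * τ (t j))) * F (act x t))
        ∂(Measure.pi fun _ => lam) = (𝒞.card : ℝ)⁻¹ *
        ∫ t, (∏ j, (1 + τ (t j))) * F t ∂(Measure.pi fun _ => lam) := by
      intro x hx
      rw [integral_const_mul, ← integral_sgn hl (hC.pm x hx) b1.1]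
      congr 1
      refine integral_congr_ae (Filter.Eventually.of_forall fun t => ?_)
      simp only
      congr 1
      exact Finset.prod_congr rfl fun j _ => by rw [hτ.sgn (hC.pm x hx j)]
    rw [Finset.sum_congr rfl this, Finset.sum_const, nsmul_eq_mul, ← mul_assoc,
      mul_inv_cancel₀ hC.card_pos.ne', one_mul]
  · intro x _
    exact ((BM.const _).mul ((bp x).mul (hF.comp (measurable_act x)))).integrable _

/-- Second moment functional. -/
noncomputable def ms (τ : ℝ → ℝ) (𝒞 : Finset (Fin N → ℝ)) (lam : Measure ℝ) (i : Fin N)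
    (S : Finset (Fin N)) : ℝ :=
  ∫ t, Dd τ 𝒞 S t * fd τ 𝒞 i S t ^ 2 ∂(Measure.pi fun _ => lam)

/-- Information functional. -/
noncomputable def Ls (τ : ℝ → ℝ) (𝒞 : Finset (Fin N → ℝ)) (lam : Measure ℝ)
    (S : Finset (Fin N)) : ℝ :=
  ∫ t, Dd τ 𝒞 S t * Real.log (Dd τ 𝒞 S t) ∂(Measure.pi fun _ => lam)

/-- Information increment. -/
noncomputable def Es (τ : ℝ → ℝ) (𝒞 : Finset (Fin N → ℝ)) (lam : Measure ℝ) (i : Fin N)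
    (S : Finset (Fin N)) : ℝ := Jf τ 𝒞 lam i (fun u f => eta (u * f)) S

lemma DL_bm (hτ : Soft τ) (S : Finset (Fin N)) :
    BM (fun t => Dd τ 𝒞 S t * Real.log (Dd τ 𝒞 S t)) :=
  (Dd_bm hτ S).cont Real.continuous_mul_log

lemma int_f (hτ : Soft τ) (hC : SG 𝒞) (hl : SymM lam) (i : Fin N) (T : Finset (Fin N)) :
    ∫ t, fd τ 𝒞 i T t ∂(Measure.pi fun _ => tilt τ lam) = ms τ 𝒞 lam i T := by
  rw [integral_pi_tilt hτ hl, avg hτ hC hl (fun x => x i) (fd_bm hτ hC i T)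
    (fun x hx t => fd_act hτ hC hx i T t), marg hτ hl _ (Finset.subset_univ T) (fd_bm hτ hC i T)
    (fd_dep i T)]
  unfold ms
  refine integral_congr_ae (Filter.Eventually.of_forall fun t => ?_)
  have := fd_mul hτ hC i T t
  unfold Nd at this
  simp only
  rw [← this]; ring

lemma int_ff (hτ : Soft τ) (hC : SG 𝒞) (hl : SymM lam) (i : Fin N) {A T : Finset (Fin N)}
    (hA : A ⊆ T) :
    ∫ t, fd τ 𝒞 i T t * fd τ 𝒞 i A t ∂(Measure.pi fun _ => tilt τ lam) = ms τ 𝒞 lam i A := by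
  have b := (fd_bm hτ hC i T).mul (fd_bm hτ hC i A)
  rw [integral_pi_tilt hτ hl, avg hτ hC hl (fun x => 1) b
    (fun x hx t => by
      rw [fd_act hτ hC hx i T t, fd_act hτ hC hx i A t]
      linear_combination (fd τ 𝒞 i T t * fd τ 𝒞 i A t) * hC.sq hx i),
    marg hτ hl _ (Finset.subset_univ T) b]
  · have e : ∀ t, Wd τ 𝒞 (fun _ => 1) T t * (fd τ 𝒞 i T t * fd τ 𝒞 i A t)
        = Wd τ 𝒞 (fun x => x i) T t * fd τ 𝒞 i A t := by
      intro t
      have := fd_mul hτ hC i T t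
      unfold Nd Dd at this
      rw [← this]; ring
    simp only [e]
    rw [marg hτ hl _ hA (fd_bm hτ hC i A) (fd_dep i A)]
    unfold ms
    refine integral_congr_ae (Filter.Eventually.of_forall fun t => ?_)
    have := fd_mul hτ hC i A t
    unfold Nd at this
    simp only
    rw [← this]; ring
  · intro t t' h
    simp only
    rw [fd_dep i T t t' h, fd_dep i A t t' fun j hj => h j (hA hj)]

lemma int_sq (hτ : Soft τ) (hC : SG 𝒞) (hl : SymM lam) (i : Fin N) (T : Finset (Fin N)) :
    ∫ t, fd τ 𝒞 i T t ^ 2 ∂(Measure.pi fun _ => tilt τ lam) = ms τ 𝒞 lam i T := by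
  rw [← int_ff hτ hC hl i (Finset.Subset.refl T)]
  simp only [sq]

theorem thresh {K : Type*} [Fintype K] (c : ℝ) (hτ : Soft τ) (hC : SG 𝒞) (hl : SymM lam)
    (i : Fin N) (T : Finset (Fin N)) (A : K → Finset (Fin N)) (hA : ∀ k, A k ⊆ T)
    (hc : ∀ j, ∃ s : Finset K, (∀ k ∈ s, j ∉ A k) ∧ c ≤ s.card) :
    c * (ms τ 𝒞 lam i T - ms τ 𝒞 lam i T ^ 2)
      ≤ ∑ k, (ms τ 𝒞 lam i T - ms τ 𝒞 lam i (A k)) := by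
  have hp := tilt_prob hτ hl
  have := variance_ineq c (tilt τ lam) N (fun k => (A k : Set (Fin N))) (fd τ 𝒞 i T)
    (fun k => fd τ 𝒞 i (A k)) (fd_bm hτ hC i T) (fun k => fd_bm hτ hC i (A k))
    (fun k => fd_dep i (A k)) (by simpa using hc)
  rw [int_sq hτ hC hl, int_f hτ hC hl] at this
  refine this.trans (le_of_eq (Finset.sum_congr rfl fun k _ => ?_))
  have bf := fd_bm hτ hC i T
  have bg := fd_bm hτ hC i (A k)
  have e : ∀ t, (fd τ 𝒞 i T t - fd τ 𝒞 i (A k) t) ^ 2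
      = fd τ 𝒞 i T t ^ 2 - 2 * (fd τ 𝒞 i T t * fd τ 𝒞 i (A k) t) + fd τ 𝒞 i (A k) t ^ 2 :=
    fun t => by ring
  simp only [e]
  rw [integral_add (((bf.pow 2).sub ((BM.const 2).mul (bf.mul bg))).integrable _)
    ((bg.pow 2).integrable _), integral_sub ((bf.pow 2).integrable _)
    (((BM.const 2).mul (bf.mul bg)).integrable _), integral_const_mul, int_sq hτ hC hl,
    int_sq hτ hC hl, int_ff hτ hC hl i (hA k)]
  ring

/-- Channel second moment. -/
noncomputable def q1 (τ : ℝ → ℝ) (lam : Measure ℝ) : ℝ := ∫ y, τ y ^ 2 ∂lam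

lemma q1_nonneg : 0 ≤ q1 τ lam := integral_nonneg fun y => sq_nonneg _

lemma int_tau_sq (hτ : Soft τ) (hC : SG 𝒞) {i : Fin N} {S : Finset (Fin N)} (hi : i ∉ S) :
    ∫ t, Dd τ 𝒞 S t * (τ (t i) * fd τ 𝒞 i S t) ^ 2 ∂(Measure.pi fun _ => lam)
      = q1 τ lam * ms τ 𝒞 lam i S := by
  unfold q1 ms
  rw [← integral_coord i (u := fun y => τ y ^ 2) ((Dd_bm hτ S).mul ((fd_bm hτ hC i S).pow 2))]
  · refine integral_congr_ae (Filter.Eventually.of_forall fun t => ?_)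
    simp only; ring
  · intro t t' h
    simp only
    rw [fd_dep' i hi t t' h, Dd, Dd, Wd_dep' _ hi t t' h]

lemma int_tau (hτ : Soft τ) (hC : SG 𝒞) (hl : SymM lam) {i : Fin N} {S : Finset (Fin N)}
    (hi : i ∉ S) :
    ∫ t, Dd τ 𝒞 S t * (τ (t i) * fd τ 𝒞 i S t) ∂(Measure.pi fun _ => lam) = 0 := by
  have : ∫ t, τ (t i) * (Dd τ 𝒞 S t * fd τ 𝒞 i S t) ∂(Measure.pi fun _ => lam) = 0 := by
    rw [integral_coord i (u := τ) ((Dd_bm hτ S).mul (fd_bm hτ hC i S)), hτ.int_zero hl, zero_mul]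
    intro t t' h
    simp only
    rw [fd_dep' i hi t t' h, Dd, Dd, Wd_dep' _ hi t t' h]
  rw [← this]
  refine integral_congr_ae (Filter.Eventually.of_forall fun t => ?_)
  simp only; ring

lemma tauf_bd (hτ : Soft τ) (hC : SG 𝒞) (i : Fin N) (S : Finset (Fin N)) (t) :
    -1 ≤ τ (t i) * fd τ 𝒞 i S t := by
  have : |τ (t i) * fd τ 𝒞 i S t| ≤ 1 := by
    rw [abs_mul]; exact mul_le_one₀ (hτ.bd _) (abs_nonneg _) (fd_le hτ hC i S t)
  exact (abs_le.mp this).1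

lemma tf_bm (hτ : Soft τ) (hC : SG 𝒞) (i : Fin N) (S : Finset (Fin N)) :
    BM (fun t => τ (t i) * fd τ 𝒞 i S t) :=
  (hτ.bm.comp (measurable_pi_apply i)).mul (fd_bm hτ hC i S)

lemma Es_bm (hτ : Soft τ) (hC : SG 𝒞) (i : Fin N) (S : Finset (Fin N)) :
    BM (fun t => Dd τ 𝒞 S t * eta (τ (t i) * fd τ 𝒞 i S t)) :=
  (Dd_bm hτ S).mul ((tf_bm hτ hC i S).cont eta_cont)

lemma Es_nonneg (hτ : Soft τ) (hC : SG 𝒞) (hl : SymM lam) {i : Fin N} {S : Finset (Fin N)}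
    (hi : i ∉ S) : 0 ≤ Es τ 𝒞 lam i S := by
  rw [← int_tau (lam := lam) hτ hC hl hi]
  unfold Es Jf
  exact integral_mono (((Dd_bm hτ S).mul (tf_bm hτ hC i S)).integrable _)
    ((Es_bm hτ hC i S).integrable _) fun t =>
      mul_le_mul_of_nonneg_left (le_eta (tauf_bd hτ hC i S t)) (Dd_nonneg hτ hC S t)

lemma Es_le (hτ : Soft τ) (hC : SG 𝒞) (hl : SymM lam) {i : Fin N} {S : Finset (Fin N)}
    (hi : i ∉ S) : Es τ 𝒞 lam i S ≤ q1 τ lam * ms τ 𝒞 lam i S := by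
  have b1 := (Dd_bm (𝒞 := 𝒞) hτ S).mul (tf_bm hτ hC i S)
  have b2 := (Dd_bm (𝒞 := 𝒞) hτ S).mul ((tf_bm hτ hC i S).pow 2)
  have h : q1 τ lam * ms τ 𝒞 lam i S = ∫ t, (Dd τ 𝒞 S t * (τ (t i) * fd τ 𝒞 i S t)
      + Dd τ 𝒞 S t * (τ (t i) * fd τ 𝒞 i S t) ^ 2) ∂(Measure.pi fun _ => lam) := by
    rw [integral_add (b1.integrable _) (b2.integrable _), int_tau hτ hC hl hi,
      int_tau_sq hτ hC hi, zero_add]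
  rw [h]
  unfold Es Jf
  refine integral_mono ((Es_bm hτ hC i S).integrable _) ((b1.add b2).integrable _) fun t => ?_
  have := mul_le_mul_of_nonneg_left (eta_le (tauf_bd hτ hC i S t)) (Dd_nonneg hτ hC S t)
  simp only; linarith

lemma J_psi1 (hτ : Soft τ) (hC : SG 𝒞) {i : Fin N} {S : Finset (Fin N)} (hi : i ∉ S) :
    Jf τ 𝒞 lam i psi1 S = Es τ 𝒞 lam i S - q1 τ lam / 4 * ms τ 𝒞 lam i S := by
  have b2 := (Dd_bm (𝒞 := 𝒞) hτ S).mul ((tf_bm hτ hC i S).pow 2)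
  have h := int_tau_sq (lam := lam) hτ hC hi
  unfold Es Jf psi1
  rw [div_mul_eq_mul_div, ← h, ← integral_div, ← integral_sub ((Es_bm hτ hC i S).integrable _)
    ((b2.integrable _).div_const _)]
  refine integral_congr_ae (Filter.Eventually.of_forall fun t => ?_)
  simp only; ring

lemma Es_diff (hτ : Soft τ) (hC : SG 𝒞) (hl : SymM lam) {i : Fin N} {A S : Finset (Fin N)}
    (hA : A ⊆ S) (hi : i ∉ S) :
    q1 τ lam / 4 * (ms τ 𝒞 lam i S - ms τ 𝒞 lam i A) ≤ Es τ 𝒞 lam i S - Es τ 𝒞 lam i A := by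
  have := J_mono (lam := lam) hτ hC hl psi1_cont (fun u hu => psi1_convex hu) hA hi
  rw [J_psi1 hτ hC hi, J_psi1 hτ hC fun h => hi (hA h)] at this
  linarith

lemma ms_mono (hτ : Soft τ) (hC : SG 𝒞) (hl : SymM lam) {i : Fin N} {A S : Finset (Fin N)}
    (hA : A ⊆ S) (hi : i ∉ S) : ms τ 𝒞 lam i A ≤ ms τ 𝒞 lam i S := by
  refine J_mono (lam := lam) (ψ := fun _ f => f ^ 2) hτ hC hl (by
    simp only [Function.uncurry_def]; fun_prop) (fun u _ => ?_) hA hi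
  exact (even_two.convexOn_pow).subset (Set.subset_univ _) (convex_Icc _ _)

lemma L_insert (hτ : Soft τ) (hC : SG 𝒞) (hl : SymM lam) {i : Fin N} {S : Finset (Fin N)}
    (hi : i ∉ S) : Ls τ 𝒞 lam (insert i S) - Ls τ 𝒞 lam S = Es τ 𝒞 lam i S := by
  have b0 := DL_bm (𝒞 := 𝒞) hτ S
  have b1 := (fd_bm hτ hC i S).mul b0
  have hz : ∫ t, τ (t i) * (fd τ 𝒞 i S t * (Dd τ 𝒞 S t * Real.log (Dd τ 𝒞 S t)))
      ∂(Measure.pi fun _ => lam) = 0 := by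
    rw [integral_coord i (u := τ) b1, hτ.int_zero hl, zero_mul]
    intro t t' h
    simp only
    rw [fd_dep' i hi t t' h, Dd, Dd, Wd_dep' _ hi t t' h]
  have bz := (hτ.bm.comp (measurable_pi_apply i)).mul b1
  have e : ∀ t, Dd τ 𝒞 (insert i S) t * Real.log (Dd τ 𝒞 (insert i S) t)
      = Dd τ 𝒞 S t * Real.log (Dd τ 𝒞 S t)
        + τ (t i) * (fd τ 𝒞 i S t * (Dd τ 𝒞 S t * Real.log (Dd τ 𝒞 S t)))
        + Dd τ 𝒞 S t * eta (τ (t i) * fd τ 𝒞 i S t) := by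
    intro t
    rw [Dd_insert hi, ← fd_mul hτ hC i S t]
    unfold eta
    rw [show Dd τ 𝒞 S t + τ (t i) * (Dd τ 𝒞 S t * fd τ 𝒞 i S t)
      = Dd τ 𝒞 S t * (1 + τ (t i) * fd τ 𝒞 i S t) by ring]
    by_cases h0 : Dd τ 𝒞 S t = 0
    · simp [h0]
    by_cases h1 : 1 + τ (t i) * fd τ 𝒞 i S t = 0
    · rw [h1]; simp
      linear_combination (-Dd τ 𝒞 S t * Real.log (Dd τ 𝒞 S t)) * h1
    rw [Real.log_mul h0 h1]; ring
  unfold Ls Es Jf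
  simp only [e]
  rw [integral_add ((b0.add bz).integrable _) ((Es_bm hτ hC i S).integrable _),
    integral_add (b0.integrable _) (bz.integrable _), hz]
  ring

lemma ms_nonneg (hτ : Soft τ) (hC : SG 𝒞) (i : Fin N) (S : Finset (Fin N)) :
    0 ≤ ms τ 𝒞 lam i S :=
  integral_nonneg fun t => mul_nonneg (Dd_nonneg hτ hC S t) (sq_nonneg _)

lemma ms_le_one (hτ : Soft τ) (hC : SG 𝒞) (hl : SymM lam) (i : Fin N) (S : Finset (Fin N)) :
    ms τ 𝒞 lam i S ≤ 1 := by
  have hp := tilt_prob hτ hl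
  rw [← int_f hτ hC hl]
  calc _ ≤ ∫ t, (1 : ℝ) ∂(Measure.pi fun _ : Fin N => tilt τ lam) :=
        integral_mono ((fd_bm hτ hC i S).integrable _) (integrable_const _)
          fun t => (abs_le.mp (fd_le hτ hC i S t)).2
    _ = 1 := by simp

lemma Ls_empty (hC : SG 𝒞) : Ls τ 𝒞 lam ∅ = 0 := by
  have h := hC.card_pos.ne'
  have : ∀ t, Dd τ 𝒞 ∅ t = 1 := fun t => by
    unfold Dd Wd
    simp [h]
  unfold Ls
  simp [this]

/-! ### Permutations -/

/-- Automorphisms. -/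
def Aut (𝒞 : Finset (Fin N → ℝ)) (σ : Equiv.Perm (Fin N)) : Prop :=
  ∀ x ∈ 𝒞, (fun j => x (σ j)) ∈ 𝒞

lemma Aut.sum {σ : Equiv.Perm (Fin N)} (h : Aut 𝒞 σ) (F : (Fin N → ℝ) → ℝ) :
    ∑ x ∈ 𝒞, F x = ∑ x ∈ 𝒞, F (fun j => x (σ j)) := by
  have hinj : Function.Injective fun (x : Fin N → ℝ) j => x (σ j) := fun x y hxy => by
    ext j
    have := congrFun hxy (σ.symm j)
    simpa using this
  have hsurj := Finset.surj_on_of_inj_on_of_card_le (s := 𝒞) (t := 𝒞)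
    (fun x _ j => x (σ j)) (fun x hx => h x hx) (fun x y _ _ hxy => hinj hxy) le_rfl
  refine (Finset.sum_bij (f := fun x : Fin N → ℝ => F (fun j => x (σ j))) (g := F)
    (fun x _ j => x (σ j)) (fun x hx => h x hx)
    (fun x _ y _ hxy => hinj hxy) (fun y hy => ?_) fun x hx => rfl).symm
  obtain ⟨x, hx, e⟩ := hsurj y hy
  exact ⟨x, hx, e.symm⟩

lemma Wd_perm (σ : Equiv.Perm (Fin N)) (h : Aut 𝒞 σ) (w : (Fin N → ℝ) → ℝ)
    (S : Finset (Fin N)) (t) :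
    Wd τ 𝒞 w S (fun j => t (σ j))
      = Wd τ 𝒞 (fun x => w (fun j => x (σ j))) (S.map σ.toEmbedding) t := by
  unfold Wd
  rw [h.sum]
  congr 1
  refine Finset.sum_congr rfl fun x _ => ?_
  congr 1
  rw [Finset.prod_map]
  rfl

lemma Ls_perm (σ : Equiv.Perm (Fin N)) (h : Aut 𝒞 σ) (S : Finset (Fin N)) :
    Ls τ 𝒞 lam (S.map σ.toEmbedding) = Ls τ 𝒞 lam S := by
  unfold Ls
  rw [← integral_perm σ (fun t => Dd τ 𝒞 S t * Real.log (Dd τ 𝒞 S t))]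
  have : ∀ t, Dd τ 𝒞 (S.map σ.toEmbedding) t = Dd τ 𝒞 S (fun j => t (σ j)) := fun t => by
    unfold Dd; rw [Wd_perm σ h]
  simp only [this]

lemma ms_perm (σ : Equiv.Perm (Fin N)) (h : Aut 𝒞 σ) (i : Fin N) (S : Finset (Fin N)) :
    ms τ 𝒞 lam (σ i) (S.map σ.toEmbedding) = ms τ 𝒞 lam i S := by
  unfold ms fd
  rw [← integral_perm σ (fun t => Dd τ 𝒞 S t * (Nd τ 𝒞 i S t / Dd τ 𝒞 S t) ^ 2)]
  have h1 : ∀ t, Dd τ 𝒞 (S.map σ.toEmbedding) t = Dd τ 𝒞 S (fun j => t (σ j)) := fun t => by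
    unfold Dd; rw [Wd_perm σ h]
  have h2 : ∀ t, Nd τ 𝒞 (σ i) (S.map σ.toEmbedding) t = Nd τ 𝒞 i S (fun j => t (σ j)) :=
    fun t => by unfold Nd; rw [Wd_perm σ h]
  simp only [h1, h2]

end integrals
end

end RMB

namespace RMB

section
variable {N : ℕ} {τ : ℝ → ℝ} {𝒞 : Finset (Fin N → ℝ)}

lemma Wd_mask (hτ : Soft τ) (w : (Fin N → ℝ) → ℝ) (T S : Finset (Fin N)) (t) :
    Wd τ 𝒞 w T (mask S t) = Wd τ 𝒞 w (T ∩ S) t := by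
  unfold Wd
  congr 1
  refine Finset.sum_congr rfl fun x _ => ?_
  congr 1
  rw [← Finset.prod_ite_mem]
  refine Finset.prod_congr rfl fun j _ => ?_
  unfold mask
  split_ifs
  · rfl
  · simp [hτ.zero]

/-- Russo's formula. -/
lemma russo (g : Finset (Fin N) → ℝ) (s : ℝ) :
    HasDerivAt (fun s => ∑ S : Finset (Fin N), wt s S * g S)
      (∑ i, ∑ S : Finset (Fin N), wt s S * (g (insert i S) - g (S.erase i))) s := by
  have h1 : ∀ (S : Finset (Fin N)) (j : Fin N),
      HasDerivAt (fun s : ℝ => if j ∈ S then s else 1 - s) (if j ∈ S then 1 else -1) s := by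
    intro S j
    split_ifs
    · exact hasDerivAt_id s
    · exact (hasDerivAt_id s).const_sub 1
  have h2 : ∀ S : Finset (Fin N), HasDerivAt (fun s => wt s S)
      (∑ i, (∏ j ∈ Finset.univ.erase i, if j ∈ S then s else 1 - s) * (if i ∈ S then 1 else -1)) s := by
    intro S
    have := HasDerivAt.fun_finset_prod (u := Finset.univ) (fun j _ => h1 S j)
    simp only [smul_eq_mul] at this
    exact this
  have h3 := HasDerivAt.fun_sum (u := Finset.univ) (fun S (_ : S ∈ Finset.univ) =>
    (h2 S).mul_const (g S))
  refine h3.congr_deriv ?_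
  simp only [Finset.sum_mul]
  rw [Finset.sum_comm]
  refine Finset.sum_congr rfl fun i _ => ?_
  have hu : (Finset.univ : Finset (Finset (Fin N)))
      = (insert i (Finset.univ.erase i)).powerset := by
    rw [Finset.insert_erase (Finset.mem_univ i), Finset.powerset_univ]
  have hni : i ∉ Finset.univ.erase i := Finset.notMem_erase _ _
  rw [hu, Finset.sum_powerset_insert hni, Finset.sum_powerset_insert hni,
    ← Finset.sum_add_distrib, ← Finset.sum_add_distrib]
  refine Finset.sum_congr rfl fun S hS => ?_
  have hiS : i ∉ S := fun h => hni (Finset.mem_powerset.mp hS h)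
  have e1 : ∏ j ∈ Finset.univ.erase i, (if j ∈ insert i S then s else 1 - s)
      = ∏ j ∈ Finset.univ.erase i, (if j ∈ S then s else 1 - s) := by
    refine Finset.prod_congr rfl fun j hj => ?_
    have : j ≠ i := Finset.ne_of_mem_erase hj
    simp [this]
  have w1 : wt s S = (1 - s) * ∏ j ∈ Finset.univ.erase i, (if j ∈ S then s else 1 - s) := by
    unfold wt
    rw [← Finset.mul_prod_erase _ _ (Finset.mem_univ i)]
    simp [hiS]
  have w2 : wt s (insert i S) = s * ∏ j ∈ Finset.univ.erase i, (if j ∈ S then s else 1 - s) := by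
    unfold wt
    rw [← Finset.mul_prod_erase _ _ (Finset.mem_univ i), e1]
    simp
  rw [e1, w1, w2]
  simp only [Finset.mem_insert_self, hiS, if_true, if_false, Finset.insert_idem,
    Finset.erase_insert hiS, Finset.erase_eq_of_notMem hiS]
  ring

lemma wt_map (σ : Equiv.Perm (Fin N)) (s : ℝ) (S : Finset (Fin N)) :
    wt s (S.map σ.toEmbedding) = wt s S := by
  unfold wt
  rw [← Equiv.prod_comp σ]
  refine Finset.prod_congr rfl fun j _ => ?_
  simp

lemma sum_map (σ : Equiv.Perm (Fin N)) (F : Finset (Fin N) → ℝ) :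
    ∑ S : Finset (Fin N), F S = ∑ S : Finset (Fin N), F (S.map σ.toEmbedding) := by
  have := Equiv.sum_comp σ.finsetCongr F
  rw [← this]
  rfl

lemma wt_one (g : Finset (Fin N) → ℝ) : ∑ S : Finset (Fin N), wt 1 S * g S = g Finset.univ := by
  rw [Finset.sum_eq_single Finset.univ]
  · simp [wt]
  · intro S _ hS
    obtain ⟨j, hj⟩ : ∃ j, j ∉ S := by
      by_contra h; push Not at h; exact hS (Finset.eq_univ_iff_forall.mpr h)
    have : wt (1 : ℝ) S = 0 := Finset.prod_eq_zero (Finset.mem_univ j) (by simp [hj])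
    rw [this, zero_mul]
  · simp

lemma wt_zero (g : Finset (Fin N) → ℝ) : ∑ S : Finset (Fin N), wt 0 S * g S = g ∅ := by
  rw [Finset.sum_eq_single ∅]
  · simp [wt]
  · intro S _ hS
    obtain ⟨j, hj⟩ := Finset.nonempty_iff_ne_empty.mpr hS
    have : wt (0 : ℝ) S = 0 := Finset.prod_eq_zero (Finset.mem_univ j) (by simp [hj])
    rw [this, zero_mul]
  · simp

variable {lam : Measure ℝ} [IsProbabilityMeasure lam]

lemma ms_erl (hτ : Soft τ) (hC : SG 𝒞) {s : ℝ} (h0 : 0 ≤ s) (h1 : s ≤ 1) (i : Fin N)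
    (T : Finset (Fin N)) :
    ms τ 𝒞 (erl s lam) i T = ∑ S : Finset (Fin N), wt s S * ms τ 𝒞 lam i (T ∩ S) := by
  have : IsProbabilityMeasure (erl s lam) := erl_prob h0 h1
  unfold ms
  rw [integral_erl h0 h1 ((Dd_bm hτ T).mul ((fd_bm hτ hC i T).pow 2))]
  simp only [fd, Dd, Nd, Wd_mask hτ]

/-- Averaged increment. -/
noncomputable def EH (τ : ℝ → ℝ) (𝒞 : Finset (Fin N → ℝ)) (lam : Measure ℝ) (i : Fin N)
    (H : Finset (Fin N)) (s : ℝ) : ℝ :=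
  ∑ S : Finset (Fin N), wt s S * Es τ 𝒞 lam i (H.erase i ∩ S)

lemma deriv_LH (hτ : Soft τ) (hC : SG 𝒞) (hl : SymM lam) {i0 : Fin N} {H : Finset (Fin N)}
    (htr : ∀ i ∈ H, ∃ σ : Equiv.Perm (Fin N), Aut 𝒞 σ ∧ σ i = i0 ∧ H.map σ.toEmbedding = H)
    (s : ℝ) :
    HasDerivAt (fun s => ∑ S : Finset (Fin N), wt s S * Ls τ 𝒞 lam (H ∩ S))
      (H.card * EH τ 𝒞 lam i0 H s) s := by
  refine (russo (fun S => Ls τ 𝒞 lam (H ∩ S)) s).congr_deriv ?_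
  have key : ∀ i, ∑ S : Finset (Fin N), wt s S *
      (Ls τ 𝒞 lam (H ∩ insert i S) - Ls τ 𝒞 lam (H ∩ S.erase i))
      = if i ∈ H then EH τ 𝒞 lam i0 H s else 0 := by
    intro i
    split_ifs with hi
    · obtain ⟨σ, hσ, hσi, hσH⟩ := htr i hi
      unfold EH
      rw [sum_map σ (fun S => wt s S * Es τ 𝒞 lam i0 (H.erase i0 ∩ S))]
      refine Finset.sum_congr rfl fun S _ => ?_
      simp only [wt_map]
      congr 1
      have e : H.erase i0 ∩ S.map σ.toEmbedding = ((H ∩ S).erase i).map σ.toEmbedding := by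
        rw [Finset.map_erase, Finset.map_inter, hσH, Finset.erase_inter]
        simp [hσi]
      rw [e, ← L_insert hτ hC hl (by rw [← e]; simp)]
      have e2 : insert i0 (((H ∩ S).erase i).map σ.toEmbedding)
          = (insert i ((H ∩ S).erase i)).map σ.toEmbedding := by
        rw [Finset.map_insert]; simp [hσi]
      rw [e2, Ls_perm σ hσ, Ls_perm σ hσ]
      congr 2
      · rw [Finset.inter_insert_of_mem hi]
        ext j; simp only [Finset.mem_insert, Finset.mem_erase]; tauto
      · rw [Finset.inter_erase]
    · refine Finset.sum_eq_zero fun S _ => ?_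
      have : H ∩ S.erase i = H ∩ S := by
        ext j; simp only [Finset.mem_inter, Finset.mem_erase]
        constructor
        · tauto
        · rintro ⟨a, b⟩; exact ⟨a, fun h => hi (h ▸ a), b⟩
      rw [Finset.inter_insert_of_notMem hi, this, sub_self, mul_zero]
  simp only [key]
  rw [Finset.sum_ite_mem, Finset.univ_inter, Finset.sum_const, nsmul_eq_mul]

theorem core {K : Type*} [Fintype K] (hτ : Soft τ) (hC : SG 𝒞) (hl : SymM lam)
    {i0 : Fin N} {H : Finset (Fin N)} (hi0 : i0 ∈ H) (c : ℝ) (hc0 : 0 < c)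
    (hK : (Fintype.card K : ℝ) = 2 * c)
    (A : K → Finset (Fin N)) (hA : ∀ k, A k ⊆ Finset.univ.erase i0)
    (hc : ∀ j, ∃ s : Finset K, (∀ k ∈ s, j ∉ A k) ∧ c ≤ s.card)
    (hAm : ∀ k, ∀ ν : Measure ℝ, IsProbabilityMeasure ν → SymM ν →
      ms τ 𝒞 ν i0 (H.erase i0) ≤ ms τ 𝒞 ν i0 (A k))
    (htrN : ∀ i, ∃ σ : Equiv.Perm (Fin N), Aut 𝒞 σ ∧ σ i = i0)
    (htr : ∀ i ∈ H, ∃ σ : Equiv.Perm (Fin N), Aut 𝒞 σ ∧ σ i = i0 ∧ H.map σ.toEmbedding = H) :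
    (1 - ms τ 𝒞 lam i0 (Finset.univ.erase i0)) * (Ls τ 𝒞 lam Finset.univ / N)
      ≤ 8 * (Ls τ 𝒞 lam Finset.univ / N - Ls τ 𝒞 lam H / H.card) := by
  have hN : (N : ℝ) ≠ 0 := by
    have := i0.pos
    positivity
  have hH : (H.card : ℝ) ≠ 0 := by
    have : 0 < H.card := Finset.card_pos.mpr ⟨_, hi0⟩
    positivity
  set m1 := ms τ 𝒞 lam i0 (Finset.univ.erase i0) with hm1
  have main : ∀ s, 0 ≤ s → s ≤ 1 →
      (1 - m1) * EH τ 𝒞 lam i0 Finset.univ s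
        ≤ 8 * (EH τ 𝒞 lam i0 Finset.univ s - EH τ 𝒞 lam i0 H s) := by
    intro s h0 h1
    have hp : IsProbabilityMeasure (erl s lam) := erl_prob h0 h1
    set m := ms τ 𝒞 (erl s lam) i0 (Finset.univ.erase i0) with hm
    set mA := ms τ 𝒞 (erl s lam) i0 (H.erase i0) with hmA
    have t1 : m - m ^ 2 ≤ 2 * (m - mA) := by
      have := thresh c hτ hC (erl_sym s hl) i0 (Finset.univ.erase i0) A hA hc
      have h2 : ∑ k, (m - ms τ 𝒞 (erl s lam) i0 (A k)) ≤ ∑ k : K, (m - mA) :=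
        Finset.sum_le_sum fun k _ => sub_le_sub_left (hAm k _ hp (erl_sym s hl)) _
      rw [Finset.sum_const, nsmul_eq_mul, Finset.card_univ, hK] at h2
      have h3 := this.trans h2
      rw [← hm] at h3
      refine le_of_mul_le_mul_left ?_ hc0
      linarith
    have hmem : ∀ (G S : Finset (Fin N)), i0 ∉ G.erase i0 ∩ S := fun G S => by simp
    have hq := q1_nonneg (τ := τ) (lam := lam)
    have eE : EH τ 𝒞 lam i0 Finset.univ s ≤ q1 τ lam * m := by
      rw [hm, ms_erl hτ hC h0 h1, Finset.mul_sum]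
      refine Finset.sum_le_sum fun S _ => ?_
      rw [mul_left_comm]
      exact mul_le_mul_of_nonneg_left (Es_le hτ hC hl (hmem _ S)) (wt_nonneg h0 h1 S)
    have eE0 : 0 ≤ EH τ 𝒞 lam i0 Finset.univ s :=
      Finset.sum_nonneg fun S _ => mul_nonneg (wt_nonneg h0 h1 S) (Es_nonneg hτ hC hl (hmem _ S))
    have eD : q1 τ lam / 4 * (m - mA)
        ≤ EH τ 𝒞 lam i0 Finset.univ s - EH τ 𝒞 lam i0 H s := by
      rw [hm, hmA, ms_erl hτ hC h0 h1, ms_erl hτ hC h0 h1, ← Finset.sum_sub_distrib, EH, EH,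
        ← Finset.sum_sub_distrib, Finset.mul_sum]
      refine Finset.sum_le_sum fun S _ => ?_
      rw [← mul_sub, ← mul_sub, mul_left_comm]
      refine mul_le_mul_of_nonneg_left (Es_diff hτ hC hl ?_ (hmem _ S)) (wt_nonneg h0 h1 S)
      exact Finset.inter_subset_inter_right (Finset.erase_subset_erase _ (Finset.subset_univ _))
    have em : m ≤ m1 := by
      rw [hm, ms_erl hτ hC h0 h1]
      calc _ ≤ ∑ S : Finset (Fin N), wt s S * m1 := Finset.sum_le_sum fun S _ =>
            mul_le_mul_of_nonneg_left (ms_mono hτ hC hl Finset.inter_subset_left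
              (Finset.notMem_erase _ _)) (wt_nonneg h0 h1 S)
        _ = m1 := by rw [← Finset.sum_mul, sum_wt, one_mul]
    have em1 : m ≤ 1 := ms_le_one hτ hC (erl_sym s hl) _ _
    have a1 : (1 - m1) * EH τ 𝒞 lam i0 Finset.univ s ≤ (1 - m) * EH τ 𝒞 lam i0 Finset.univ s :=
      mul_le_mul_of_nonneg_right (by linarith) eE0
    have a2 := mul_le_mul_of_nonneg_left eE (show 0 ≤ 1 - m by linarith)
    have a3 := mul_le_mul_of_nonneg_left t1 hq
    nlinarith
  have dU := deriv_LH (τ := τ) (lam := lam) (H := Finset.univ) hτ hC hl (i0 := i0)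
    (fun i _ => by
      obtain ⟨σ, h, h'⟩ := htrN i
      exact ⟨σ, h, h', by simp⟩)
  have dH := deriv_LH (τ := τ) (lam := lam) (H := H) hτ hC hl (i0 := i0) htr
  set φ : ℝ → ℝ := fun s => (1 - m1) * ((∑ S : Finset (Fin N), wt s S *
      Ls τ 𝒞 lam (Finset.univ ∩ S)) / N) - 8 * ((∑ S : Finset (Fin N), wt s S *
      Ls τ 𝒞 lam (Finset.univ ∩ S)) / N - (∑ S : Finset (Fin N), wt s S *
      Ls τ 𝒞 lam (H ∩ S)) / H.card) with hφ
  have dφ : ∀ s, HasDerivAt φ ((1 - m1) * EH τ 𝒞 lam i0 Finset.univ s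
      - 8 * (EH τ 𝒞 lam i0 Finset.univ s - EH τ 𝒞 lam i0 H s)) s := by
    intro s
    have := (((dU s).div_const (N : ℝ)).const_mul (1 - m1)).sub
      ((((dU s).div_const (N : ℝ)).sub ((dH s).div_const (H.card : ℝ))).const_mul 8)
    refine this.congr_deriv ?_
    rw [Finset.card_univ, Fintype.card_fin]
    field_simp
  have hanti : AntitoneOn φ (Set.Icc 0 1) := by
    refine antitoneOn_of_deriv_nonpos (convex_Icc _ _)
      (fun s _ => (dφ s).continuousAt.continuousWithinAt)
      (fun s _ => (dφ s).differentiableAt.differentiableWithinAt) fun s hs => ?_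
    rw [interior_Icc] at hs
    rw [(dφ s).deriv]
    linarith [main s hs.1.le hs.2.le]
  have := hanti (Set.left_mem_Icc.mpr zero_le_one) (Set.right_mem_Icc.mpr zero_le_one) zero_le_one
  simp only [hφ, wt_one, wt_zero, Finset.inter_empty, Finset.inter_univ, Ls_empty hC] at this
  simp at this
  linarith

/-! ### Bounds on the information functional -/

/-- Product likelihood. -/
noncomputable def Px (τ : ℝ → ℝ) (x : Fin N → ℝ) (S : Finset (Fin N)) (t : Fin N → ℝ) : ℝ :=
  ∏ j ∈ S, (1 + x j * τ (t j))

lemma Px_bm (hτ : Soft τ) (x : Fin N → ℝ) (S : Finset (Fin N)) : BM (Px τ x S) :=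
    BM.prod _ fun j _ => (BM.const 1).add ((BM.const _).mul (hτ.bm.comp (measurable_pi_apply j)))

lemma Px_nonneg (hτ : Soft τ) (hC : SG 𝒞) {x} (hx : x ∈ 𝒞) (S : Finset (Fin N)) (t) :
    0 ≤ Px τ x S t := Finset.prod_nonneg fun j _ => factor_nonneg hτ hC hx j _

lemma Dd_eq (S : Finset (Fin N)) (t) :
    Dd τ 𝒞 S t = (𝒞.card : ℝ)⁻¹ * ∑ x ∈ 𝒞, Px τ x S t := by
  simp [Dd, Wd, Px]

lemma int_Px_log (hτ : Soft τ) (hl : SymM lam) :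
    ∫ t : Fin N → ℝ, Px τ (fun _ => 1) Finset.univ t * Real.log (Px τ (fun _ => 1) Finset.univ t)
      ∂(Measure.pi fun _ => lam) = N * ∫ y, eta (τ y) ∂lam := by
  have e : ∀ t : Fin N → ℝ, Px τ (fun _ => 1) Finset.univ t * Real.log (Px τ (fun _ => 1) Finset.univ t)
      = ∑ i : Fin N, ∏ j, (if j = i then eta (τ (t j)) else 1 + τ (t j)) := by
    intro t
    have hs : ∀ i : Fin N, ∏ j, (if j = i then eta (τ (t j)) else 1 + τ (t j))
        = Px τ (fun _ => 1) Finset.univ t * Real.log (1 + τ (t i)) := by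
      intro i
      unfold Px
      rw [← Finset.mul_prod_erase _ _ (Finset.mem_univ i),
        ← Finset.mul_prod_erase _ _ (Finset.mem_univ i)]
      have : ∏ j ∈ Finset.univ.erase i, (if j = i then eta (τ (t j)) else 1 + τ (t j))
          = ∏ j ∈ Finset.univ.erase i, (1 + 1 * τ (t j)) :=
        Finset.prod_congr rfl fun j hj => by simp [Finset.ne_of_mem_erase hj]
      rw [this]
      simp only [if_true, eta, one_mul]
      ring
    simp only [hs]
    rw [← Finset.mul_sum]
    by_cases h : ∃ j, 1 + τ (t j) = 0
    · obtain ⟨j, hj⟩ := h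
      have : Px τ (fun _ => 1) Finset.univ t = 0 :=
        Finset.prod_eq_zero (Finset.mem_univ j) (by simpa using hj)
      simp [this]
    · push Not at h
      congr 1
      unfold Px
      rw [Real.log_prod (fun j _ => by simpa using h j)]
      simp
  simp only [e]
  have b : BM (fun y => eta (τ y)) := hτ.bm.cont eta_cont
  rw [integral_finset_sum]
  · have : ∀ i : Fin N, ∫ t, ∏ j, (if j = i then eta (τ (t j)) else 1 + τ (t j))
        ∂(Measure.pi fun _ : Fin N => lam) = ∫ y, eta (τ y) ∂lam := by
      intro i
      have h := integral_fintype_prod_eq_prod (𝕜 := ℝ) (μ := fun _ : Fin N => lam)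
        (fun (j : Fin N) (y : ℝ) => if j = i then eta (τ y) else 1 + τ y)
      rw [h, ← Finset.mul_prod_erase _ _ (Finset.mem_univ i), Finset.prod_eq_one, mul_one]
      · simp
      · intro j hj
        simp only [Finset.ne_of_mem_erase hj, if_false]
        rw [integral_add (integrable_const _) (hτ.bm.integrable _), hτ.int_zero hl]; simp
    simp [this]
  · intro i _
    refine (BM.prod _ fun j _ => ?_).integrable _
    by_cases h : j = i
    · simp only [h, if_true]; exact b.comp (measurable_pi_apply i)
    · simp only [h, if_false]; exact (BM.const 1).add (hτ.bm.comp (measurable_pi_apply j))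

lemma int_Dd (hτ : Soft τ) (hC : SG 𝒞) (hl : SymM lam) (S : Finset (Fin N)) :
    ∫ t, Dd τ 𝒞 S t ∂(Measure.pi fun _ => lam) = 1 := by
  have := marg (lam := lam) (𝒞 := 𝒞) hτ hl (fun _ => 1) (Finset.empty_subset S) (BM.const 1)
    (fun _ _ _ => rfl)
  simp only [mul_one] at this
  unfold Dd
  rw [this]
  have h := hC.card_pos.ne'
  simp [Wd, h]

lemma int_Px (hτ : Soft τ) (hC : SG 𝒞) (hl : SymM lam) {x} (hx : x ∈ 𝒞) :
    ∫ t, Px τ x Finset.univ t * Real.log (Px τ x Finset.univ t) ∂(Measure.pi fun _ => lam)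
      = N * ∫ y, eta (τ y) ∂lam := by
  rw [← int_Px_log hτ hl, ← integral_sgn hl (hC.pm x hx)
    ((Px_bm hτ (fun _ => 1) Finset.univ).cont Real.continuous_mul_log).1]
  have : ∀ t : Fin N → ℝ, Px τ (fun _ => 1) Finset.univ (fun j => x j * t j)
      = Px τ x Finset.univ t := fun t => by
    unfold Px
    exact Finset.prod_congr rfl fun j _ => by rw [hτ.sgn (hC.pm x hx j), one_mul]
  simp only [this]

lemma L_lower (hτ : Soft τ) (hC : SG 𝒞) (hl : SymM lam) :
    N * (∫ y, eta (τ y) ∂lam) - Real.log 𝒞.card ≤ Ls τ 𝒞 lam Finset.univ := by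
  have hc := hC.card_pos
  have bP : ∀ x : Fin N → ℝ, BM (fun t => Px τ x Finset.univ t * Real.log (Px τ x Finset.univ t)) :=
    fun x => (Px_bm hτ x Finset.univ).cont Real.continuous_mul_log
  have bS : BM (fun t => (𝒞.card : ℝ)⁻¹ * ∑ x ∈ 𝒞,
      Px τ x Finset.univ t * Real.log (Px τ x Finset.univ t)) :=
    (BM.const _).mul (BM.sum _ fun x _ => bP x)
  have bD := (BM.const (Real.log 𝒞.card)).mul (Dd_bm (𝒞 := 𝒞) hτ Finset.univ)
  have e : N * (∫ y, eta (τ y) ∂lam) - Real.log 𝒞.card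
      = ∫ t, ((𝒞.card : ℝ)⁻¹ * (∑ x ∈ 𝒞,
        Px τ x Finset.univ t * Real.log (Px τ x Finset.univ t))
          - Real.log 𝒞.card * Dd τ 𝒞 Finset.univ t) ∂(Measure.pi fun _ => lam) := by
    rw [integral_sub (bS.integrable _) (bD.integrable _), integral_const_mul, integral_const_mul,
      int_Dd hτ hC hl, integral_finset_sum _ fun x _ => (bP x).integrable _,
      Finset.sum_congr rfl fun x hx => int_Px hτ hC hl hx, Finset.sum_const, nsmul_eq_mul]
    field_simp
  rw [e]
  unfold Ls
  refine integral_mono ((bS.sub bD).integrable _) ((DL_bm hτ _).integrable _) fun t => ?_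
  simp only
  rw [sub_le_iff_le_add, ← mul_comm (Dd τ 𝒞 Finset.univ t), ← mul_add]
  have : ∀ x ∈ 𝒞, Px τ x Finset.univ t * Real.log (Px τ x Finset.univ t)
      ≤ Px τ x Finset.univ t * (Real.log (Dd τ 𝒞 Finset.univ t) + Real.log 𝒞.card) := by
    intro x hx
    have h0 := Px_nonneg hτ hC hx Finset.univ t
    rcases h0.eq_or_lt with h | h
    · rw [← h]; simp
    refine mul_le_mul_of_nonneg_left ?_ h0
    have hle : Px τ x Finset.univ t ≤ Dd τ 𝒞 Finset.univ t * 𝒞.card := by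
      rw [Dd_eq, mul_comm, ← mul_assoc, mul_inv_cancel₀ hc.ne', one_mul]
      exact Finset.single_le_sum (f := fun x => Px τ x Finset.univ t)
        (fun y hy => Px_nonneg hτ hC hy _ t) hx
    have hD : 0 < Dd τ 𝒞 Finset.univ t := by
      by_contra hn
      push Not at hn
      nlinarith
    rw [← Real.log_mul hD.ne' hc.ne']
    exact Real.log_le_log h hle
  have h2 := Finset.sum_le_sum this
  rw [← Finset.sum_mul] at h2
  have h3 := mul_le_mul_of_nonneg_left h2 (inv_nonneg.mpr hc.le)
  refine h3.trans (le_of_eq ?_)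
  rw [Dd_eq]; ring

/-- Subcode trivial on `H`. -/
noncomputable def KH (𝒞 : Finset (Fin N → ℝ)) (H : Finset (Fin N)) : Finset (Fin N → ℝ) :=
  open Classical in 𝒞.filter fun x => ∀ j ∈ H, x j = 1

lemma D_split (hτ : Soft τ) (hC : SG 𝒞) (H : Finset (Fin N)) (t) :
    ((KH 𝒞 H).card * (KH 𝒞 Hᶜ).card : ℝ) * Dd τ 𝒞 Finset.univ t
      ≤ 𝒞.card * (Dd τ 𝒞 H t * Dd τ 𝒞 Hᶜ t) := by
  classical
  have hc := hC.card_pos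
  have hmem : ∀ G : Finset (Fin N), ∀ k, k ∈ KH 𝒞 G ↔ k ∈ 𝒞 ∧ ∀ j ∈ G, k j = 1 := by
    intro G k; simp [KH]
  set U : Finset ((Fin N → ℝ) × (Fin N → ℝ) × (Fin N → ℝ)) := 𝒞 ×ˢ (KH 𝒞 H ×ˢ KH 𝒞 Hᶜ) with hU
  set Φ : (Fin N → ℝ) × (Fin N → ℝ) × (Fin N → ℝ) → (Fin N → ℝ) × (Fin N → ℝ) :=
    fun p => (act p.1 p.2.1, act p.1 p.2.2) with hΦ
  have hne : ∀ x ∈ 𝒞, ∀ j, x j ≠ 0 := fun x hx j => by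
    rcases hC.pm x hx j with h | h <;> rw [h] <;> norm_num
  have hinj : Set.InjOn Φ U := by
    rintro ⟨z, k, k'⟩ hp ⟨y, l, l'⟩ hq h
    simp only [hU, Finset.coe_product, Set.mem_prod, Finset.mem_coe, hmem] at hp hq
    simp only [hΦ, Prod.mk.injEq] at h
    have hzy : z = y := by
      ext j
      by_cases hj : j ∈ H
      · have := congrFun h.1 j
        simp only [act] at this
        rw [hp.2.1.2 j hj, hq.2.1.2 j hj] at this
        linarith
      · have := congrFun h.2 j
        simp only [act] at this
        rw [hp.2.2.2 j (by simpa using hj), hq.2.2.2 j (by simpa using hj)] at this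
        linarith
    subst hzy
    have e1 : k = l := by
      ext j; exact mul_left_cancel₀ (hne z hp.1 j) (congrFun h.1 j)
    have e2 : k' = l' := by
      ext j; exact mul_left_cancel₀ (hne z hp.1 j) (congrFun h.2 j)
    rw [e1, e2]
  have hsub : U.image Φ ⊆ 𝒞 ×ˢ 𝒞 := by
    intro p hp
    obtain ⟨⟨z, k, k'⟩, hq, rfl⟩ := Finset.mem_image.mp hp
    simp only [hU, Finset.mem_product, hmem] at hq
    exact Finset.mem_product.mpr ⟨hC.mul z hq.1 k hq.2.1.1, hC.mul z hq.1 k' hq.2.2.1⟩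
  have h1 : ∑ p ∈ U.image Φ, Px τ p.1 H t * Px τ p.2 Hᶜ t
      ≤ ∑ p ∈ 𝒞 ×ˢ 𝒞, Px τ p.1 H t * Px τ p.2 Hᶜ t :=
    Finset.sum_le_sum_of_subset_of_nonneg hsub fun p hp _ => by
      rw [Finset.mem_product] at hp
      exact mul_nonneg (Px_nonneg hτ hC hp.1 _ t) (Px_nonneg hτ hC hp.2 _ t)
  rw [Finset.sum_image hinj, Finset.sum_product (s := 𝒞) (t := 𝒞)] at h1
  simp only at h1
  rw [← Finset.sum_mul_sum] at h1
  have h2 : ∑ p ∈ U, Px τ (Φ p).1 H t * Px τ (Φ p).2 Hᶜ t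
      = ∑ p ∈ U, Px τ p.1 Finset.univ t := by
    refine Finset.sum_congr rfl ?_
    rintro ⟨z, k, k'⟩ hq
    simp only [hU, Finset.mem_product, hmem] at hq
    simp only [hΦ]
    have a1 : Px τ (act z k) H t = Px τ z H t :=
      Finset.prod_congr rfl fun j hj => by simp only [act]; rw [hq.2.1.2 j hj, mul_one]
    have a2 : Px τ (act z k') Hᶜ t = Px τ z Hᶜ t :=
      Finset.prod_congr rfl fun j hj => by simp only [act]; rw [hq.2.2.2 j hj, mul_one]
    rw [a1, a2]
    exact Finset.prod_mul_prod_compl H _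
  have h3 : ∑ p ∈ U, Px τ p.1 Finset.univ t
      = ((KH 𝒞 H).card * (KH 𝒞 Hᶜ).card : ℝ) * ∑ z ∈ 𝒞, Px τ z Finset.univ t := by
    rw [hU, Finset.sum_product]
    simp only [Finset.sum_const, Finset.card_product, nsmul_eq_mul, Nat.cast_mul]
    rw [← Finset.mul_sum]
  rw [h2, h3] at h1
  rw [Dd_eq, Dd_eq, Dd_eq]
  have := mul_le_mul_of_nonneg_left h1 (inv_nonneg.mpr hc.le)
  calc _ = (𝒞.card : ℝ)⁻¹ * (((KH 𝒞 H).card * (KH 𝒞 Hᶜ).card : ℝ)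
        * ∑ z ∈ 𝒞, Px τ z Finset.univ t) := by ring
    _ ≤ _ := this
    _ = _ := by field_simp

lemma KH_pos (hC : SG 𝒞) (H : Finset (Fin N)) : (0 : ℝ) < (KH 𝒞 H).card := by
  have : (fun _ => (1 : ℝ)) ∈ KH 𝒞 H := by simp [KH, hC.one]
  exact_mod_cast Finset.card_pos.mpr ⟨_, this⟩

lemma trunc_le {d ε : ℝ} (hd : 0 ≤ d) (hε : 0 < ε) :
    d * Real.log (max d ε) ≤ d * Real.log d + ε := by
  rcases hd.eq_or_lt with rfl | h
  · simp [hε.le]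
  rcases le_total ε d with h1 | h1
  · rw [max_eq_left h1]; linarith
  · rw [max_eq_right h1]
    have := Real.log_le_sub_one_of_pos (div_pos hε h)
    rw [Real.log_div hε.ne' h.ne'] at this
    have h2 := mul_le_mul_of_nonneg_left this h.le
    rw [mul_sub, mul_sub, mul_div_cancel₀ _ h.ne'] at h2
    linarith

lemma L_split (hτ : Soft τ) (hC : SG 𝒞) (hl : SymM lam) (H : Finset (Fin N)) :
    Ls τ 𝒞 lam Finset.univ ≤ Ls τ 𝒞 lam H + Ls τ 𝒞 lam Hᶜ
      + (Real.log 𝒞.card - Real.log (KH 𝒞 H).card - Real.log (KH 𝒞 Hᶜ).card) := by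
  set κ := Real.log 𝒞.card - Real.log (KH 𝒞 H).card - Real.log (KH 𝒞 Hᶜ).card with hκ
  have hc := hC.card_pos
  have hk := KH_pos hC H
  have hk' := KH_pos hC Hᶜ
  refine le_of_forall_pos_le_add fun ε0 hε0 => ?_
  set ε := ε0 / 2 with hε
  have he : 0 < ε := by positivity
  have bg : ∀ G : Finset (Fin N), BM (fun t => Real.log (max (Dd τ 𝒞 G t) ε)) := by
    intro G
    have := (Dd_bm (𝒞 := 𝒞) hτ G).cont (ψ := fun d => Real.log (max d ε))
      (Continuous.log (by fun_prop) fun d => (lt_max_of_lt_right he).ne')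
    exact this
  have hg : ∀ G : Finset (Fin N), ∫ t, Dd τ 𝒞 Finset.univ t * Real.log (max (Dd τ 𝒞 G t) ε)
      ∂(Measure.pi fun _ => lam) ≤ Ls τ 𝒞 lam G + ε := by
    intro G
    have := marg (lam := lam) (𝒞 := 𝒞) hτ hl (fun _ => 1) (Finset.subset_univ G) (bg G)
      (fun t t' h => by
        have : Dd τ 𝒞 G t = Dd τ 𝒞 G t' := Wd_dep _ G t t' h
        rw [this])
    unfold Dd at this ⊢
    rw [this]
    calc _ ≤ ∫ t, (Dd τ 𝒞 G t * Real.log (Dd τ 𝒞 G t) + ε) ∂(Measure.pi fun _ => lam) :=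
          integral_mono (((Dd_bm hτ G).mul (bg G)).integrable _)
            (((DL_bm hτ G).add (BM.const ε)).integrable _) fun t =>
              trunc_le (Dd_nonneg hτ hC G t) he
      _ = _ := by
          rw [integral_add ((DL_bm hτ G).integrable _) (integrable_const _)]
          simp [Ls]
  have b1 := (Dd_bm (𝒞 := 𝒞) hτ Finset.univ).mul (bg H)
  have b2 := (Dd_bm (𝒞 := 𝒞) hτ Finset.univ).mul (bg Hᶜ)
  have b3 := (Dd_bm (𝒞 := 𝒞) hτ Finset.univ).mul (BM.const κ)
  calc Ls τ 𝒞 lam Finset.univ ≤ ∫ t, (Dd τ 𝒞 Finset.univ t * Real.log (max (Dd τ 𝒞 H t) ε)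
        + Dd τ 𝒞 Finset.univ t * Real.log (max (Dd τ 𝒞 Hᶜ t) ε)
        + Dd τ 𝒞 Finset.univ t * κ) ∂(Measure.pi fun _ => lam) := by
        refine integral_mono ((DL_bm hτ _).integrable _) (((b1.add b2).add b3).integrable _)
          fun t => ?_
        simp only
        rw [← mul_add, ← mul_add]
        have h0 := Dd_nonneg hτ hC Finset.univ t
        rcases h0.eq_or_lt with h | h
        · rw [← h]; simp
        refine mul_le_mul_of_nonneg_left ?_ h0
        have hs := D_split hτ hC H t
        have h1 : 0 < max (Dd τ 𝒞 H t) ε := lt_max_of_lt_right he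
        have h2 : 0 < max (Dd τ 𝒞 Hᶜ t) ε := lt_max_of_lt_right he
        have hm : Dd τ 𝒞 H t * Dd τ 𝒞 Hᶜ t ≤ max (Dd τ 𝒞 H t) ε * max (Dd τ 𝒞 Hᶜ t) ε :=
          mul_le_mul (le_max_left _ _) (le_max_left _ _) (Dd_nonneg hτ hC _ t) h1.le
        have hm2 := hs.trans (mul_le_mul_of_nonneg_left hm hc.le)
        have := Real.log_le_log (by positivity) hm2
        rw [Real.log_mul (by positivity) h.ne', Real.log_mul hk.ne' hk'.ne',
          Real.log_mul hc.ne' (by positivity), Real.log_mul h1.ne' h2.ne'] at this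
        linarith
    _ = ∫ t, Dd τ 𝒞 Finset.univ t * Real.log (max (Dd τ 𝒞 H t) ε) ∂(Measure.pi fun _ => lam)
        + ∫ t, Dd τ 𝒞 Finset.univ t * Real.log (max (Dd τ 𝒞 Hᶜ t) ε) ∂(Measure.pi fun _ => lam)
        + κ := by
        rw [integral_add ((b1.add b2).integrable _) (b3.integrable _),
          integral_add (b1.integrable _) (b2.integrable _), integral_mul_const, int_Dd hτ hC hl,
          one_mul]
    _ ≤ _ := by
        have := hg H
        have := hg Hᶜ
        linarith

theorem core2 {K : Type*} [Fintype K] (hτ : Soft τ) (hC : SG 𝒞) (hl : SymM lam)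
    {i0 : Fin N} {H : Finset (Fin N)} (hi0 : i0 ∈ H) (c : ℝ) (hc0 : 0 < c)
    (hK : (Fintype.card K : ℝ) = 2 * c)
    (A : K → Finset (Fin N)) (hA : ∀ k, A k ⊆ Finset.univ.erase i0)
    (hc : ∀ j, ∃ s : Finset K, (∀ k ∈ s, j ∉ A k) ∧ c ≤ s.card)
    (hAm : ∀ k, ∀ ν : Measure ℝ, IsProbabilityMeasure ν → SymM ν →
      ms τ 𝒞 ν i0 (H.erase i0) ≤ ms τ 𝒞 ν i0 (A k))
    (htrN : ∀ i, ∃ σ : Equiv.Perm (Fin N), Aut 𝒞 σ ∧ σ i = i0)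
    (htr : ∀ i ∈ H, ∃ σ : Equiv.Perm (Fin N), Aut 𝒞 σ ∧ σ i = i0 ∧ H.map σ.toEmbedding = H)
    (hHc : ∃ σ : Equiv.Perm (Fin N), Aut 𝒞 σ ∧ H.map σ.toEmbedding = Hᶜ) :
    (1 - ms τ 𝒞 lam i0 (Finset.univ.erase i0)) *
        (N * (∫ y, eta (τ y) ∂lam) - Real.log 𝒞.card)
      ≤ 8 * (Real.log 𝒞.card - Real.log (KH 𝒞 H).card - Real.log (KH 𝒞 Hᶜ).card) := by
  obtain ⟨σ, hσ, hσH⟩ := hHc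
  have h1 := core hτ hC hl hi0 c hc0 hK A hA hc hAm htrN htr
  have h2 := L_lower (lam := lam) hτ hC hl
  have h3 := L_split (lam := lam) hτ hC hl H
  have h4 : Ls τ 𝒞 lam Hᶜ = Ls τ 𝒞 lam H := by rw [← hσH, Ls_perm σ hσ]
  have h5 := ms_le_one (lam := lam) hτ hC hl i0 (Finset.univ.erase i0)
  have hcard : H.card + H.card = N := by
    have := Finset.card_add_card_compl H
    rw [← hσH, Finset.card_map, Fintype.card_fin] at this
    exact this
  have hN : (N : ℝ) = 2 * H.card := by
    have : ((H.card + H.card : ℕ) : ℝ) = N := by rw [hcard]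
    push_cast at this; linarith
  have hHp : (0 : ℝ) < H.card := by exact_mod_cast Finset.card_pos.mpr ⟨_, hi0⟩
  rw [h4] at h3
  have h6 := mul_le_mul_of_nonneg_left h2
    (show 0 ≤ 1 - ms τ 𝒞 lam i0 (Finset.univ.erase i0) by linarith)
  have h7 := mul_le_mul_of_nonneg_right h1 (show (0 : ℝ) ≤ N by rw [hN]; positivity)
  have e1 : (1 - ms τ 𝒞 lam i0 (Finset.univ.erase i0)) * (Ls τ 𝒞 lam Finset.univ / N) * N
      = (1 - ms τ 𝒞 lam i0 (Finset.univ.erase i0)) * Ls τ 𝒞 lam Finset.univ := by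
    have : (N : ℝ) ≠ 0 := by rw [hN]; positivity
    field_simp
  have e2 : 8 * (Ls τ 𝒞 lam Finset.univ / N - Ls τ 𝒞 lam H / H.card) * N
      = 8 * (Ls τ 𝒞 lam Finset.univ - 2 * Ls τ 𝒞 lam H) := by
    rw [hN]; field_simp
  rw [e1, e2] at h7
  linarith

end

end RMB

namespace RMB

/-! ### Reed-Muller codes -/

/-- Evaluation points. -/
abbrev V (m : ℕ) := Fin m → ZMod 2

/-- Bits of an index. -/
def bt {m : ℕ} (i : Fin (2 ^ m)) : V m := fun j => ((((i : ℕ) / 2 ^ (j : ℕ)) % 2 : ℕ) : ZMod 2)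

lemma bt_inj {m : ℕ} : Function.Injective (bt (m := m)) := by
  intro i k h
  ext
  refine Nat.eq_of_testBit_eq fun j => ?_
  by_cases hj : j < m
  · have := congrFun h ⟨j, hj⟩
    simp only [bt] at this
    rw [ZMod.natCast_eq_natCast_iff'] at this
    simp only [Nat.mod_mod] at this
    rw [Nat.testBit_eq_decide_div_mod_eq, Nat.testBit_eq_decide_div_mod_eq, this]
  · push Not at hj
    have h2 := Nat.pow_le_pow_right (show 0 < 2 by norm_num) hj
    rw [Nat.testBit_lt_two_pow (i.2.trans_le h2), Nat.testBit_lt_two_pow (k.2.trans_le h2)]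

/-- Index equivalence. -/
noncomputable def ev (m : ℕ) : Fin (2 ^ m) ≃ V m :=
  Equiv.ofBijective bt ((Fintype.bijective_iff_injective_and_card _).mpr ⟨bt_inj, by simp [V]⟩)

lemma ev_apply {m : ℕ} (i : Fin (2 ^ m)) : ev m i = bt i := rfl

/-- Monomials. -/
def mono {m : ℕ} (S : Finset (Fin m)) : V m → ZMod 2 := fun v => ∏ j ∈ S, v j

/-- Polynomial functions of degree at most `r`. -/
def Pol (r m : ℕ) : Submodule (ZMod 2) (V m → ZMod 2) :=
  Submodule.span (ZMod 2) (Set.image mono {S : Finset (Fin m) | S.card ≤ r})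

lemma z2sq (a : ZMod 2) : a * a = a := by revert a; decide

lemma mono_mul {m : ℕ} (S T : Finset (Fin m)) : mono S * mono T = mono (S ∪ T) := by
  classical
  funext v
  simp only [mono, Pi.mul_apply]
  induction S using Finset.induction_on with
  | empty => simp
  | insert k S hk ih =>
    rw [Finset.prod_insert hk, mul_assoc, ih, Finset.insert_union]
    by_cases h : k ∈ S ∪ T
    · rw [Finset.insert_eq_of_mem h, ← Finset.mul_prod_erase _ _ h, ← mul_assoc, z2sq]
    · rw [Finset.prod_insert h]

lemma mono_mem {r m : ℕ} {S : Finset (Fin m)} (h : S.card ≤ r) : mono S ∈ Pol r m :=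
  Submodule.subset_span ⟨S, h, rfl⟩

lemma Pol_mono {r r' m : ℕ} (h : r ≤ r') : Pol r m ≤ Pol r' m :=
  Submodule.span_mono (Set.image_mono fun _ hS => le_trans hS h)

lemma Pol_mul {a b m : ℕ} {p q : V m → ZMod 2} (hp : p ∈ Pol a m) (hq : q ∈ Pol b m) :
    p * q ∈ Pol (a + b) m := by
  have := Submodule.mul_mem_mul hp hq
  unfold Pol at this
  rw [Submodule.span_mul_span] at this
  refine (Submodule.span_le.mpr ?_) this
  rintro _ ⟨_, ⟨S, hS, rfl⟩, _, ⟨T, hT, rfl⟩, rfl⟩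
  simp only
  rw [mono_mul]
  exact mono_mem ((Finset.card_union_le _ _).trans (add_le_add hS hT))

lemma Pol_const {r m : ℕ} (c : ZMod 2) : (fun _ => c : V m → ZMod 2) ∈ Pol r m := by
  have : (fun _ => c : V m → ZMod 2) = c • mono ∅ := by funext v; simp [mono]
  rw [this]
  exact Submodule.smul_mem _ _ (mono_mem (by simp))

lemma Pol_coord {m : ℕ} (j : Fin m) : (fun v => v j : V m → ZMod 2) ∈ Pol 1 m := by
  have : (fun v => v j : V m → ZMod 2) = mono {j} := by funext v; simp [mono]
  rw [this]
  exact mono_mem (by simp)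

lemma Pol_comp {r m : ℕ} {g : V m → V m} (hg : ∀ j, (fun v => g v j) ∈ Pol 1 m)
    {p : V m → ZMod 2} (hp : p ∈ Pol r m) : (fun v => p (g v)) ∈ Pol r m := by
  classical
  have h1 : ∀ S : Finset (Fin m), (fun v => mono S (g v)) ∈ Pol S.card m := by
    intro S
    induction S using Finset.induction_on with
    | empty => simpa [mono] using Pol_const (r := 0) (m := m) 1
    | insert k S hk ih =>
      have := Pol_mul (hg k) ih
      rw [Finset.card_insert_of_notMem hk, add_comm]
      convert this using 1
      funext v
      simp [mono, Finset.prod_insert hk]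
  refine Submodule.span_induction (p := fun p _ => (fun v => p (g v)) ∈ Pol r m) ?_ ?_ ?_ ?_ hp
  · rintro _ ⟨S, hS, rfl⟩
    exact Pol_mono hS (h1 S)
  · exact Submodule.zero_mem _
  · intro p q _ _ h h'
    exact Submodule.add_mem _ h h'
  · intro c p _ h
    exact Submodule.smul_mem _ c h

/-- Sign character. -/
noncomputable def chi (a : ZMod 2) : ℝ := (-1) ^ a.val

lemma chi_zero : chi 0 = 1 := by simp [chi]
lemma z2cases (a : ZMod 2) : a = 0 ∨ a = 1 := by revert a; decide
lemma chi_one : chi 1 = -1 := by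
  show (-1 : ℝ) ^ 1 = -1
  norm_num
lemma chi_add (a b : ZMod 2) : chi (a + b) = chi a * chi b := by
  rcases z2cases a with rfl | rfl <;> rcases z2cases b with rfl | rfl
  · simp [chi_zero]
  · simp [chi_zero]
  · simp [chi_zero]
  · rw [show (1 + 1 : ZMod 2) = 0 by decide, chi_zero, chi_one]; norm_num
lemma chi_inj {a b : ZMod 2} (h : chi a = chi b) : a = b := by
  rcases z2cases a with rfl | rfl <;> rcases z2cases b with rfl | rfl <;>
    simp [chi_zero, chi_one] at h ⊢ <;> norm_num at h

lemma Pol_iff {r m : ℕ} (p : V m → ZMod 2) : p ∈ Pol r m ↔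
    ∃ α : Finset (Fin m) → ZMod 2, p = fun v =>
      ∑ S ∈ Finset.univ.filter (fun S : Finset (Fin m) => S.card ≤ r), α S * mono S v := by
  constructor
  · intro hp
    refine Submodule.span_induction (p := fun p _ => ∃ α : Finset (Fin m) → ZMod 2, p = fun v =>
      ∑ S ∈ Finset.univ.filter (fun S : Finset (Fin m) => S.card ≤ r), α S * mono S v)
      ?_ ?_ ?_ ?_ hp
    · rintro _ ⟨S, hS, rfl⟩
      refine ⟨fun T => if T = S then 1 else 0, ?_⟩
      funext v
      have hS' : S.card ≤ r := hS
      simp [hS']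
    · exact ⟨fun _ => 0, by funext v; simp⟩
    · rintro p q _ _ ⟨α, rfl⟩ ⟨β, rfl⟩
      refine ⟨fun S => α S + β S, ?_⟩
      funext v
      simp [add_mul, Finset.sum_add_distrib]
    · rintro c p _ ⟨α, rfl⟩
      refine ⟨fun S => c * α S, ?_⟩
      funext v
      simp [Finset.mul_sum, mul_assoc]
  · rintro ⟨α, rfl⟩
    have : (fun v => ∑ S ∈ Finset.univ.filter (fun S : Finset (Fin m) => S.card ≤ r),
        α S * mono S v) = ∑ S ∈ Finset.univ.filter (fun S : Finset (Fin m) => S.card ≤ r),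
        α S • mono S := by funext v; simp
    rw [this]
    exact Submodule.sum_mem _ fun S hS => Submodule.smul_mem _ _ (mono_mem (by simpa using hS))

lemma mem_bpskRM {r m : ℕ} (x : Fin (2 ^ m) → ℝ) :
    x ∈ bpskRM r m ↔ ∃ p ∈ Pol r m, x = fun i => chi (p (ev m i)) := by
  simp only [bpskRM, bpskImage, RMcode, Finset.mem_image, Finset.mem_univ, true_and]
  constructor
  · rintro ⟨_, ⟨α, rfl⟩, rfl⟩
    exact ⟨_, (Pol_iff _).mpr ⟨α, rfl⟩, rfl⟩
  · rintro ⟨p, hp, rfl⟩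
    obtain ⟨α, rfl⟩ := (Pol_iff p).mp hp
    exact ⟨_, ⟨α, rfl⟩, rfl⟩

lemma RM_SG (r m : ℕ) : SG (bpskRM r m) where
  pm := by
    intro x hx i
    obtain ⟨p, _, rfl⟩ := (mem_bpskRM x).mp hx
    rcases z2cases (p (ev m i)) with h | h <;> simp [h, chi_zero, chi_one]
  mul := by
    intro x hx y hy
    obtain ⟨p, hp, rfl⟩ := (mem_bpskRM x).mp hx
    obtain ⟨q, hq, rfl⟩ := (mem_bpskRM y).mp hy
    refine (mem_bpskRM _).mpr ⟨p + q, Submodule.add_mem _ hp hq, ?_⟩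
    funext i
    simp [chi_add]
  one := (mem_bpskRM _).mpr ⟨0, Submodule.zero_mem _, by funext i; simp [chi_zero]⟩

lemma RM_aut (r m : ℕ) (g : Equiv.Perm (V m)) (hg : ∀ j, (fun v => g v j) ∈ Pol 1 m) :
    Aut (bpskRM r m) ((ev m).trans (g.trans (ev m).symm)) := by
  intro x hx
  obtain ⟨p, hp, rfl⟩ := (mem_bpskRM x).mp hx
  refine (mem_bpskRM _).mpr ⟨_, Pol_comp hg hp, ?_⟩
  funext i
  simp

/-- Dot products. -/
def dt {m : ℕ} (a v : V m) : ZMod 2 := ∑ j, a j * v j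

lemma dt_add {m : ℕ} (a v w : V m) : dt a (v + w) = dt a v + dt a w := by
  simp [dt, mul_add, Finset.sum_add_distrib]
lemma dt_smul {m : ℕ} (a : V m) (c : ZMod 2) (w : V m) : dt a (c • w) = c * dt a w := by
  simp only [dt, Finset.mul_sum, Pi.smul_apply, smul_eq_mul]
  exact Finset.sum_congr rfl fun j _ => by ring
lemma add_dt {m : ℕ} (a b v : V m) : dt (a + b) v = dt a v + dt b v := by
  simp [dt, add_mul, Finset.sum_add_distrib]
lemma dt_single {m : ℕ} (a : V m) (j : Fin m) : dt a (Pi.single j 1) = a j := by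
  simp [dt, Pi.single_apply]
lemma single_dt {m : ℕ} (a : V m) (j : Fin m) : dt (Pi.single j 1) a = a j := by
  simp [dt, Pi.single_apply]
lemma add_self2 {m : ℕ} (v : V m) : v + v = 0 := by
  funext j; exact CharTwo.add_self_eq_zero _
lemma dt_Pol {m : ℕ} (a : V m) : (fun v => dt a v) ∈ Pol 1 m := by
  have : (fun v => dt a v) = ∑ j, a j • (fun v : V m => v j) := by
    funext v; simp [dt]
  rw [this]
  exact Submodule.sum_mem _ fun j _ => Submodule.smul_mem _ _ (Pol_coord j)

/-- Transvections and translations. -/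
def tv {m : ℕ} (a u : V m) (c : ZMod 2) (h : dt a u = 0) : Equiv.Perm (V m) :=
  Function.Involutive.toPerm (fun v => v + (dt a v + c) • u) (by
    intro v
    simp only
    rw [dt_add, dt_smul, h, mul_zero, add_zero, add_assoc, add_self2, add_zero])

lemma tv_apply {m : ℕ} (a u : V m) (c : ZMod 2) (h : dt a u = 0) (v) :
    tv a u c h v = v + (dt a v + c) • u := rfl

lemma tv_Pol {m : ℕ} (a u : V m) (c : ZMod 2) (h : dt a u = 0) (j : Fin m) :
    (fun v => tv a u c h v j) ∈ Pol 1 m := by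
  have : (fun v => tv a u c h v j)
      = (fun v : V m => v j) + u j • ((fun v => dt a v) + (fun _ => c)) := by
    funext v; simp [tv_apply]; ring
  rw [this]
  exact Submodule.add_mem _ (Pol_coord j) (Submodule.smul_mem _ _
    (Submodule.add_mem _ (dt_Pol a) (Pol_const c)))

/-- The induced permutation of indices. -/
noncomputable def pv {m : ℕ} (a u : V m) (c : ZMod 2) (h : dt a u = 0) :
    Equiv.Perm (Fin (2 ^ m)) := (ev m).trans ((tv a u c h).trans (ev m).symm)

lemma pv_aut (r : ℕ) {m : ℕ} (a u : V m) (c : ZMod 2) (h : dt a u = 0) :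
    Aut (bpskRM r m) (pv a u c h) := RM_aut r m _ (tv_Pol a u c h)

lemma pv_apply {m : ℕ} (a u : V m) (c : ZMod 2) (h : dt a u = 0) (i) :
    ev m (pv a u c h i) = ev m i + (dt a (ev m i) + c) • u := by
  simp [pv, tv_apply]

lemma map_eq {N : ℕ} {σ : Equiv.Perm (Fin N)} {A B : Finset (Fin N)}
    (h : ∀ i, i ∈ A ↔ σ i ∈ B) : A.map σ.toEmbedding = B := by
  ext i
  rw [Finset.mem_map_equiv, h, Equiv.apply_symm_apply]

/-- The half space. -/
noncomputable def HS {n : ℕ} (i0 : Fin (2 ^ (n + 1))) : Finset (Fin (2 ^ (n + 1))) :=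
  Finset.univ.filter fun i => ev (n + 1) i 0 = ev (n + 1) i0 0

/-- The punctured hyperplanes. -/
noncomputable def AS {n : ℕ} (i0 : Fin (2 ^ (n + 1))) (a : V (n + 1)) :
    Finset (Fin (2 ^ (n + 1))) :=
  Finset.univ.filter fun i => i ≠ i0 ∧ dt a (ev (n + 1) i + ev (n + 1) i0) = 0

lemma half_card {n : ℕ} {w : V (n + 1)} (hw : w ≠ 0) :
    2 ^ n ≤ (Finset.univ.filter fun a : V (n + 1) => dt a w ≠ 0).card := by
  classical
  obtain ⟨k, hk⟩ : ∃ k, w k ≠ 0 := by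
    by_contra h; push Not at h; exact hw (funext h)
  have hk1 : w k = 1 := (z2cases _).resolve_left hk
  have h1 : (Finset.univ.filter fun a : V (n + 1) => ¬ (dt a w ≠ 0)).card
      ≤ (Finset.univ.filter fun a : V (n + 1) => dt a w ≠ 0).card := by
    refine Finset.card_le_card_of_injOn (fun a => a + Pi.single k 1) ?_ ?_
    · intro a ha
      simp only [Finset.coe_filter, Finset.mem_univ, true_and, Set.mem_setOf_eq, not_not] at ha ⊢
      rw [add_dt, ha, single_dt, hk1]; decide
    · intro a _ b _ h
      exact add_right_cancel h
  have h2 := Finset.card_filter_add_card_filter_not (s := (Finset.univ : Finset (V (n + 1))))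
    (fun a => dt a w ≠ 0)
  have h3 : (Finset.univ : Finset (V (n + 1))).card = 2 ^ (n + 1) := by
    simp [V]
  rw [h3, pow_succ] at h2
  omega

lemma z2_eq_iff (a b : ZMod 2) : a = b ↔ a + b = 0 := by revert a b; decide

theorem RM_core {r n : ℕ} {τ : ℝ → ℝ} {lam : Measure ℝ} [IsProbabilityMeasure lam]
    (hτ : Soft τ) (hl : SymM lam) (i0 : Fin (2 ^ (n + 1))) :
    (1 - ms τ (bpskRM r (n + 1)) lam i0 (Finset.univ.erase i0)) *
        ((2 ^ (n + 1) : ℕ) * (∫ y, eta (τ y) ∂lam) - Real.log (bpskRM r (n + 1)).card)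
      ≤ 8 * (Real.log (bpskRM r (n + 1)).card - Real.log (KH (bpskRM r (n + 1)) (HS i0)).card
        - Real.log (KH (bpskRM r (n + 1)) (HS i0)ᶜ).card) := by
  have hC := RM_SG r (n + 1)
  have hev : Function.Injective (ev (n + 1)) := (ev (n + 1)).injective
  have z0 : ∀ u : V (n + 1), dt 0 u = 0 := fun u => by simp [dt]
  refine core2 (K := V (n + 1)) hτ hC hl (i0 := i0) (H := HS i0) (by simp [HS]) (2 ^ n)
    (by positivity) (by simp [V, pow_succ, mul_comm]) (AS i0) ?_ ?_ ?_ ?_ ?_ ?_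
  · intro a i hi
    simp only [AS, Finset.mem_filter] at hi
    simpa using hi.2.1
  · intro j
    by_cases hj : j = i0
    · refine ⟨Finset.univ, fun a _ => by simp [AS, hj], ?_⟩
      have h3 : (Finset.univ : Finset (V (n + 1))).card = 2 ^ (n + 1) := by simp [V]
      rw [h3]; push_cast
      exact pow_le_pow_right₀ (by norm_num) (by omega)
    · have hw : ev (n + 1) j + ev (n + 1) i0 ≠ 0 := by
        intro h
        apply hj
        apply hev
        funext k
        exact (z2_eq_iff _ _).mpr (congrFun h k)
      refine ⟨_, fun a ha => ?_, by exact_mod_cast half_card hw⟩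
      simp only [Finset.mem_filter, Finset.mem_univ, true_and] at ha
      simp [AS, ha]
  · intro a ν hν hs
    by_cases ha : a = 0
    · refine ms_mono hτ hC hs ?_ (by simp [AS])
      intro i hi
      rw [Finset.mem_erase] at hi
      simp [AS, hi.1, ha, z0]
    · obtain ⟨u, hu, hu0⟩ : ∃ u : V (n + 1), dt a u = 1 ∧ u 0 = 1 := by
        by_cases h0 : a 0 = 0
        · obtain ⟨k, hk⟩ : ∃ k, a k ≠ 0 := by
            by_contra h; push Not at h; exact ha (funext h)
          have hk1 : a k = 1 := (z2cases _).resolve_left hk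
          have hk0 : (0 : Fin (n + 1)) ≠ k := fun h => hk (h ▸ h0)
          refine ⟨Pi.single 0 1 + Pi.single k 1, ?_, ?_⟩
          · rw [dt_add, dt_single, dt_single, h0, hk1]; decide
          · simp [Pi.single_apply, hk0]
        · refine ⟨Pi.single 0 1, ?_, by simp⟩
          rw [dt_single]; exact (z2cases _).resolve_left h0
      have hb : dt (a + Pi.single 0 1) u = 0 := by
        rw [add_dt, single_dt, hu, hu0]; decide
      set v0 := ev (n + 1) i0 with hv0
      set σ := pv (a + Pi.single 0 1) u (dt (a + Pi.single 0 1) v0) hb with hσ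
      have hσi : σ i0 = i0 := by
        apply hev
        rw [hσ, pv_apply, ← hv0, CharTwo.add_self_eq_zero, zero_smul, add_zero]
      have hmap : (AS i0 a).map σ.toEmbedding = (HS i0).erase i0 := by
        refine map_eq fun i => ?_
        have e1 : σ i ≠ i0 ↔ i ≠ i0 := by
          rw [Ne, Ne, not_iff_not]
          constructor
          · intro h; exact σ.injective (h.trans hσi.symm)
          · intro h; rw [h, hσi]
        have e2 : (ev (n + 1) (σ i)) 0 + v0 0 = dt a (ev (n + 1) i + v0) := by
          rw [hσ, pv_apply, Pi.add_apply, Pi.smul_apply, hu0, add_dt, add_dt, single_dt, single_dt,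
            dt_add, smul_eq_mul, mul_one]
          generalize dt a (ev (n + 1) i) = p
          generalize dt a v0 = q
          generalize ev (n + 1) i 0 = x
          generalize v0 0 = y
          revert p q x y; decide
        simp only [AS, HS, Finset.mem_filter, Finset.mem_univ, true_and, Finset.mem_erase, e1]
        rw [← hv0, z2_eq_iff ((ev (n + 1) (σ i)) 0), e2]
      have := ms_perm (τ := τ) (lam := ν) σ (pv_aut r _ _ _ _) i0 (AS i0 a)
      rw [hmap, hσi] at this
      exact this.le
  · intro i
    refine ⟨pv 0 (ev (n + 1) i + ev (n + 1) i0) 1 (z0 _), pv_aut r _ _ _ _, ?_⟩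
    apply hev
    rw [pv_apply, z0, zero_add, one_smul, ← add_assoc, add_self2, zero_add]
  · intro i hi
    have hi' : ev (n + 1) i 0 = ev (n + 1) i0 0 := by simpa [HS] using hi
    refine ⟨pv 0 (ev (n + 1) i + ev (n + 1) i0) 1 (z0 _), pv_aut r _ _ _ _, ?_, ?_⟩
    · apply hev
      rw [pv_apply, z0, zero_add, one_smul, ← add_assoc, add_self2, zero_add]
    · refine map_eq fun k => ?_
      simp only [HS, Finset.mem_filter, Finset.mem_univ, true_and]
      rw [pv_apply, z0, zero_add, one_smul, Pi.add_apply, Pi.add_apply, hi',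
        CharTwo.add_self_eq_zero, add_zero]
  · refine ⟨pv 0 (Pi.single 0 1) 1 (z0 _), pv_aut r _ _ _ _, ?_⟩
    refine map_eq fun k => ?_
    simp only [HS, Finset.mem_filter, Finset.mem_univ, true_and, Finset.mem_compl]
    rw [pv_apply, z0, zero_add, one_smul, Pi.add_apply, Pi.single_eq_same]
    generalize ev (n + 1) k 0 = x
    generalize ev (n + 1) i0 0 = y
    revert x y; decide

end RMB

namespace RMB

/-- Sum of binomials. -/
def bs (m r : ℕ) : ℕ := ∑ i ∈ Finset.range r, m.choose i

lemma card_lt (m r : ℕ) : Fintype.card {S : Finset (Fin m) // S.card < r} = bs m r := by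
  classical
  rw [Fintype.card_subtype]
  rw [Finset.card_eq_sum_card_fiberwise (f := Finset.card) (t := Finset.range r)
    (by intro S hS; simpa using hS)]
  refine Finset.sum_congr rfl fun i hi => ?_
  rw [Finset.filter_filter]
  have : (Finset.univ.filter fun S : Finset (Fin m) => S.card < r ∧ S.card = i)
      = Finset.powersetCard i Finset.univ := by
    ext S
    simp only [Finset.mem_filter, Finset.mem_univ, true_and, Finset.mem_powersetCard,
      Finset.subset_univ]
    rw [Finset.mem_range] at hi
    constructor
    · exact fun h => h.2
    · intro h; exact ⟨h ▸ hi, h⟩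
  rw [this, Finset.card_powersetCard]
  simp

lemma bs_pascal (n r : ℕ) : bs (n + 1) (r + 1) = 2 * bs n r + n.choose r := by
  unfold bs
  rw [Finset.sum_range_succ']
  simp only [Nat.choose_succ_succ, Finset.sum_add_distrib, Nat.choose_zero_right]
  have h := Finset.sum_range_succ' (fun i => n.choose i) r
  rw [Finset.sum_range_succ] at h
  simp only [Nat.choose_zero_right] at h
  simp only [Nat.succ_eq_add_one]
  omega

lemma card_RM_le (r m : ℕ) : (bpskRM r m).card ≤ 2 ^ bs m (r + 1) := by
  classical
  let F : ({S : Finset (Fin m) // S.card < r + 1} → ZMod 2) → (Fin (2 ^ m) → ℝ) :=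
    fun β i => chi (∑ S, β S * mono S.1 (ev m i))
  have : bpskRM r m ⊆ Finset.univ.image F := by
    intro x hx
    obtain ⟨p, hp, rfl⟩ := (mem_bpskRM x).mp hx
    obtain ⟨α, rfl⟩ := (Pol_iff p).mp hp
    rw [Finset.mem_image]
    refine ⟨fun S => α S.1, Finset.mem_univ _, ?_⟩
    funext i
    simp only [F]
    congr 1
    rw [Finset.sum_subtype (p := fun S : Finset (Fin m) => S.card < r + 1)]
    intro S; simp [Nat.lt_succ_iff]
  refine (Finset.card_le_card this).trans (Finset.card_image_le.trans ?_)
  rw [Finset.card_univ, Fintype.card_fun, card_lt, ZMod.card]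

/-- Polynomials vanishing on a half space. -/
def hp {n r : ℕ} (c : ZMod 2) (β : {S : Finset (Fin n) // S.card < r} → ZMod 2) :
    V (n + 1) → ZMod 2 := fun v => (v 0 + c) * ∑ S, β S * ∏ j ∈ S.1, v j.succ

lemma hp_Pol {n r : ℕ} (c : ZMod 2) (β : {S : Finset (Fin n) // S.card < r} → ZMod 2) :
    hp c β ∈ Pol r (n + 1) := by
  classical
  rcases Nat.eq_zero_or_pos r with rfl | hr
  · have : hp c β = 0 := by
      funext v
      have : IsEmpty {S : Finset (Fin n) // S.card < 0} := ⟨fun S => by simpa using S.2⟩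
      simp [hp]
    rw [this]; exact Submodule.zero_mem _
  · obtain ⟨s, rfl⟩ : ∃ s, r = s + 1 := ⟨r - 1, by omega⟩
    have e : hp c β = ((fun v : V (n + 1) => v 0) + fun _ => c) *
        ∑ S, β S • mono (S.1.map (Fin.succEmb n)) := by
      funext v
      simp [hp, mono]
    rw [e]
    refine Pol_mono (le_of_eq (add_comm 1 s)) (Pol_mul (Submodule.add_mem _ (Pol_coord 0) (Pol_const c)) ?_)
    refine Submodule.sum_mem _ fun S _ => Submodule.smul_mem _ _ (mono_mem ?_)
    rw [Finset.card_map]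
    exact Nat.lt_succ_iff.mp S.2

lemma hp_inj {n r : ℕ} (c : ZMod 2) : Function.Injective (hp (n := n) (r := r) c) := by
  classical
  intro β γ h
  have key : ∀ k : ℕ, ∀ S : {S : Finset (Fin n) // S.card < r}, S.1.card = k → β S = γ S := by
    intro k
    induction k using Nat.strong_induction_on with
    | _ k ih =>
    intro S hS
    have := congrFun h (Fin.cons (c + 1) fun j => if j ∈ S.1 then 1 else 0)
    simp only [hp, Fin.cons_zero, Fin.cons_succ] at this
    have hc : c + 1 + c = 1 := by
      clear this h ih
      revert c; decide
    rw [hc, one_mul, one_mul, ← Finset.add_sum_erase _ _ (Finset.mem_univ S),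
      ← Finset.add_sum_erase _ (fun T => γ T * _) (Finset.mem_univ S)] at this
    have h1 : ∑ T ∈ Finset.univ.erase S, β T * ∏ j ∈ T.1, (if j ∈ S.1 then (1 : ZMod 2) else 0)
        = ∑ T ∈ Finset.univ.erase S, γ T * ∏ j ∈ T.1, (if j ∈ S.1 then (1 : ZMod 2) else 0) := by
      refine Finset.sum_congr rfl fun T hT => ?_
      by_cases hTS : T.1 ⊆ S.1
      · have hne : T.1 ≠ S.1 := fun hh => (Finset.mem_erase.mp hT).1 (Subtype.ext hh)
        rw [ih _ (hS ▸ Finset.card_lt_card (hTS.ssubset_of_ne hne)) T rfl]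
      · obtain ⟨j, hj, hj'⟩ := Finset.not_subset.mp hTS
        rw [Finset.prod_eq_zero hj (by simp [hj'])]; simp
    rw [h1] at this
    have h2 := add_right_cancel this
    rwa [Finset.prod_congr rfl (fun j hj => if_pos hj), Finset.prod_const_one, mul_one,
      mul_one] at h2
  funext S
  exact key _ S rfl

lemma card_KH_ge (n r : ℕ) (c : ZMod 2) (H : Finset (Fin (2 ^ (n + 1))))
    (hH : ∀ i ∈ H, ev (n + 1) i 0 = c) : 2 ^ bs n r ≤ (KH (bpskRM r (n + 1)) H).card := by
  classical
  have h0 : 2 ^ bs n r = (Finset.univ : Finset ({S : Finset (Fin n) // S.card < r} → ZMod 2)).card := by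
    rw [Finset.card_univ, Fintype.card_fun, card_lt, ZMod.card]
  rw [h0]
  refine Finset.card_le_card_of_injOn (fun β i => chi (hp c β (ev (n + 1) i))) ?_ ?_
  · intro β _
    simp only [KH, Finset.coe_filter, Set.mem_setOf_eq]
    refine ⟨(mem_bpskRM _).mpr ⟨_, hp_Pol c β, rfl⟩, fun j hj => ?_⟩
    simp only [hp, hH j hj, CharTwo.add_self_eq_zero, zero_mul, chi_zero]
  · intro β _ γ _ h
    apply hp_inj c
    funext v
    have := congrFun h ((ev (n + 1)).symm v)
    simp only [Equiv.apply_symm_apply] at this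
    exact chi_inj this

lemma log_card_ge {k s : ℕ} (h : 2 ^ s ≤ k) : s * Real.log 2 ≤ Real.log k := by
  rw [← Real.log_pow]
  exact Real.log_le_log (by positivity) (by exact_mod_cast h)

lemma log_card_le {k s : ℕ} (hk : 0 < k) (h : k ≤ 2 ^ s) : Real.log k ≤ s * Real.log 2 := by
  rw [← Real.log_pow]
  exact Real.log_le_log (by exact_mod_cast hk) (by exact_mod_cast h)

lemma cb_bound (k : ℕ) : k.centralBinom ^ 2 * (2 * k + 1) ≤ 16 ^ k := by
  induction k with
  | zero => simp
  | succ k ih =>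
    have h := Nat.succ_mul_centralBinom_succ k
    have h2 : (k + 1) ^ 2 * ((k + 1).centralBinom ^ 2 * (2 * (k + 1) + 1))
        ≤ (k + 1) ^ 2 * 16 ^ (k + 1) := by
      calc (k + 1) ^ 2 * ((k + 1).centralBinom ^ 2 * (2 * (k + 1) + 1))
          = ((k + 1) * (k + 1).centralBinom) ^ 2 * (2 * k + 3) := by ring
        _ = (k.centralBinom ^ 2 * (2 * k + 1)) * (4 * ((2 * k + 1) * (2 * k + 3))) := by
            rw [h]; ring
        _ ≤ 16 ^ k * (4 * ((2 * k + 1) * (2 * k + 3))) := Nat.mul_le_mul_right _ ih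
        _ ≤ 16 ^ k * (16 * (k + 1) ^ 2) := Nat.mul_le_mul_left _ (by nlinarith)
        _ = (k + 1) ^ 2 * 16 ^ (k + 1) := by ring
    exact Nat.le_of_mul_le_mul_left h2 (by positivity)

lemma choose_bound (n r : ℕ) : (n + 1) * (n.choose r) ^ 2 ≤ 4 ^ n := by
  have h1 := Nat.choose_le_middle r n
  have h2 : (n + 1) * (n.choose (n / 2)) ^ 2 ≤ 4 ^ n := by
    obtain ⟨k, hk | hk⟩ := Nat.even_or_odd' n
    · subst hk
      have := cb_bound k
      rw [Nat.centralBinom] at this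
      rw [Nat.mul_div_cancel_left _ (by norm_num), pow_mul]
      norm_num
      nlinarith
    · subst hk
      have e : (2 * k + 1) / 2 = k := by omega
      rw [e]
      have e2 : 2 * (2 * k + 1).choose k = (k + 1).centralBinom := by
        rw [Nat.centralBinom, show 2 * (k + 1) = (2 * k + 1) + 1 by ring, Nat.choose_succ_succ,
          Nat.choose_symm_half]; ring
      have := cb_bound (k + 1)
      rw [← e2] at this
      have e3 : 16 ^ (k + 1) = 4 * 4 ^ (2 * k + 1) := by
        rw [show (16 : ℕ) = 4 ^ 2 by norm_num, ← pow_mul]; ring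
      rw [e3] at this
      nlinarith
  calc _ ≤ (n + 1) * (n.choose (n / 2)) ^ 2 := by gcongr
    _ ≤ _ := h2

theorem M_bound {r n : ℕ} {τ : ℝ → ℝ} {lam : Measure ℝ} [IsProbabilityMeasure lam]
    (hτ : Soft τ) (hl : SymM lam) (i0 : Fin (2 ^ (n + 1))) {C : ℝ}
    (hC : ∫ y, eta (τ y) ∂lam = C * Real.log 2) (hR : RMrate r (n + 1) < C) :
    1 - ms τ (bpskRM r (n + 1)) lam i0 (Finset.univ.erase i0)
      ≤ rho (n + 1) / (C - RMrate r (n + 1)) := by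
  have hcore := RM_core (r := r) hτ hl i0
  set M := 1 - ms τ (bpskRM r (n + 1)) lam i0 (Finset.univ.erase i0) with hM
  have hM0 : 0 ≤ M := by
    have := ms_le_one (lam := lam) hτ (RM_SG r (n + 1)) hl i0 (Finset.univ.erase i0)
    linarith
  have hl2 : 0 < Real.log 2 := Real.log_pos (by norm_num)
  have h1 := log_card_le (by exact_mod_cast (RM_SG r (n + 1)).card_pos) (card_RM_le r (n + 1))
  have h2 := log_card_ge (card_KH_ge n r (ev (n + 1) i0 0) (HS i0) (by simp [HS]))
  have h3 := log_card_ge (card_KH_ge n r (ev (n + 1) i0 0 + 1) (HS i0)ᶜ (by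
    intro i hi
    simp only [HS, Finset.mem_compl, Finset.mem_filter, Finset.mem_univ, true_and] at hi
    revert hi
    generalize ev (n + 1) i 0 = x
    generalize ev (n + 1) i0 0 = y
    revert x y; decide))
  have hp := bs_pascal n r
  have hp' : (bs (n + 1) (r + 1) : ℝ) = 2 * bs n r + n.choose r := by exact_mod_cast hp
  have hrate : (bs (n + 1) (r + 1) : ℝ) = 2 ^ (n + 1) * RMrate r (n + 1) := by
    rw [RMrate, mul_inv_cancel_left₀ (by positivity)]
    simp [bs]
  rw [hC] at hcore
  have h4 : M * (2 ^ (n + 1) * (C - RMrate r (n + 1))) ≤ 8 * n.choose r := by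
    have a1 : M * (2 ^ (n + 1) * (C - RMrate r (n + 1)) * Real.log 2)
        ≤ 8 * n.choose r * Real.log 2 := by
      calc _ ≤ M * ((2 ^ (n + 1) : ℕ) * (C * Real.log 2) - Real.log (bpskRM r (n + 1)).card) := by
            apply mul_le_mul_of_nonneg_left _ hM0
            rw [hrate] at h1
            push_cast
            linarith
        _ ≤ _ := hcore
        _ ≤ _ := by rw [hp'] at h1; nlinarith
    have a2 : (M * (2 ^ (n + 1) * (C - RMrate r (n + 1)))) * Real.log 2
        ≤ (8 * n.choose r) * Real.log 2 := by linarith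
    exact le_of_mul_le_mul_right a2 hl2
  have hs : (n.choose r : ℝ) * Real.sqrt (n + 1) ≤ 2 ^ n := by
    have := choose_bound n r
    have h' : ((n : ℝ) + 1) * (n.choose r : ℝ) ^ 2 ≤ 4 ^ n := by exact_mod_cast this
    apply abs_le_of_sq_le_sq' _ (by positivity) |>.2
    rw [mul_pow, Real.sq_sqrt (by positivity), ← pow_mul, mul_comm n 2, pow_mul]
    norm_num
    linarith
  have hsp : 0 < Real.sqrt ((n : ℝ) + 1) := Real.sqrt_pos.mpr (by positivity)
  have hd : 0 < C - RMrate r (n + 1) := by linarith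
  rw [le_div_iff₀ hd, rho, le_div_iff₀ (by push_cast; positivity)]
  push_cast
  have hlog : 0 ≤ Real.log ((n : ℝ) + 1) := Real.log_nonneg (by linarith [Nat.cast_nonneg (α := ℝ) n])
  have h5 : M * (C - RMrate r (n + 1)) * Real.sqrt (n + 1) ≤ 4 := by
    have : (M * (C - RMrate r (n + 1)) * Real.sqrt (n + 1)) * 2 ^ (n + 1) ≤ 4 * 2 ^ (n + 1) := by
      calc _ = M * (2 ^ (n + 1) * (C - RMrate r (n + 1))) * Real.sqrt (n + 1) := by ring
        _ ≤ 8 * n.choose r * Real.sqrt (n + 1) := mul_le_mul_of_nonneg_right h4 hsp.le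
        _ ≤ 8 * 2 ^ n := by linarith
        _ = _ := by ring
    exact le_of_mul_le_mul_right this (by positivity)
  linarith

end RMB

namespace RMB

/-! ### The channel -/

/-- Symmetrized noise law. -/
noncomputable def slam (P : Measure ℝ) : Measure ℝ :=
  (2 : ENNReal)⁻¹ • (P + P.map (fun y => -y))

section channel
variable (P : Measure ℝ) [IsProbabilityMeasure P]

lemma map_neg_prob : IsProbabilityMeasure (P.map (fun y : ℝ => -y)) :=
  Measure.isProbabilityMeasure_map (by fun_prop)

lemma slam_prob : IsProbabilityMeasure (slam P) := by
  have := map_neg_prob P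
  constructor
  simp only [slam, Measure.smul_apply, Measure.add_apply, measure_univ, smul_eq_mul]
  rw [one_add_one_eq_two, ENNReal.inv_mul_cancel (by norm_num) (by norm_num)]

lemma slam_sym : SymM (slam P) := by
  unfold SymM slam
  rw [Measure.map_smul, Measure.map_add _ _ (by fun_prop), Measure.map_map (by fun_prop) (by fun_prop)]
  have : ((fun y : ℝ => -y) ∘ fun y => -y) = id := by funext y; simp
  rw [this, Measure.map_id, add_comm]

lemma ac_slam : P ≪ slam P := by
  intro s hs
  simp only [slam, Measure.smul_apply, Measure.add_apply, smul_eq_mul, mul_eq_zero,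
    ENNReal.inv_eq_zero, ENNReal.ofNat_ne_top, false_or, add_eq_zero] at hs
  exact hs.1

lemma exists_tau : ∃ τ : ℝ → ℝ, Soft τ ∧ P = tilt τ (slam P) := by
  have hp := slam_prob P
  set l := slam P with hl
  set d := P.rnDeriv l with hd
  have hdm : Measurable d := Measure.measurable_rnDeriv _ _
  have hPd : l.withDensity d = P := Measure.withDensity_rnDeriv_eq P l (ac_slam P)
  have hsym : l.map (fun y => -y) = l := slam_sym P
  have hQ : P.map (fun y => -y) = l.withDensity (fun y => d (-y)) := by
    ext s hs
    rw [Measure.map_apply (by fun_prop) hs]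
    conv_lhs => rw [← hPd]
    rw [withDensity_apply _ (measurable_neg hs), withDensity_apply _ hs]
    conv_rhs => rw [← hsym]
    rw [setLIntegral_map hs (by fun_prop) (by fun_prop)]
    simp
  have h1 : (fun y => (2 : ENNReal)⁻¹ * (d y + d (-y))) =ᵐ[l] fun _ => 1 := by
    rw [← withDensity_eq_iff_of_sigmaFinite (by fun_prop) (by fun_prop)]
    have e : l.withDensity (fun y => (2 : ENNReal)⁻¹ * (d y + d (-y))) = l := by
      have : (fun y => (2 : ENNReal)⁻¹ * (d y + d (-y)))
          = (2 : ENNReal)⁻¹ • (d + fun y => d (-y)) := by funext y; simp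
      rw [this, withDensity_smul _ (by fun_prop), withDensity_add_left hdm, hPd, ← hQ]
      rfl
    rw [e, withDensity_const, one_smul]
  refine ⟨fun y => max (-1) (min 1 (((d y).toReal - (d (-y)).toReal) / 2)), ⟨by fun_prop, ?_, ?_⟩, ?_⟩
  · intro y
    simp only [neg_neg]
    have : ((d (-y)).toReal - (d y).toReal) / 2 = -(((d y).toReal - (d (-y)).toReal) / 2) := by ring
    rw [this]
    generalize ((d y).toReal - (d (-y)).toReal) / 2 = g
    rcases le_total (-1) g with h | h <;> rcases le_total g 1 with h' | h'
    · rw [min_eq_right (by linarith), min_eq_right h', max_eq_right (by linarith), max_eq_right h]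
    · rw [min_eq_right (by linarith), min_eq_left h', max_eq_left (by linarith),
        max_eq_right (by norm_num)]
    · rw [min_eq_left (by linarith), min_eq_right h', max_eq_right (by linarith), max_eq_left h]
      norm_num
    · linarith
  · intro y
    rw [abs_le]
    exact ⟨le_max_left _ _, max_le (by norm_num) (min_le_left _ _)⟩
  · conv_lhs => rw [← hPd]
    unfold tilt
    apply withDensity_congr_ae
    filter_upwards [h1] with y hy
    have hs : d y + d (-y) = 2 := by
      have := congrArg (fun z => 2 * z) hy
      rwa [← mul_assoc, ENNReal.mul_inv_cancel (by norm_num) (by norm_num), one_mul, mul_one] at this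
    have ha : d y ≠ ⊤ := by intro h; rw [h] at hs; simp at hs
    have hb : d (-y) ≠ ⊤ := by intro h; rw [h] at hs; simp at hs
    have hr : (d y).toReal + (d (-y)).toReal = 2 := by
      rw [← ENNReal.toReal_add ha hb, hs]; simp
    have h0 : 0 ≤ (d y).toReal := ENNReal.toReal_nonneg
    have h0' : 0 ≤ (d (-y)).toReal := ENNReal.toReal_nonneg
    rw [min_eq_right (by linarith), max_eq_right (by linarith)]
    rw [show 1 + ((d y).toReal - (d (-y)).toReal) / 2 = (d y).toReal by linarith,
      ENNReal.ofReal_toReal ha]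

instance sign_prob : IsProbabilityMeasure signMeasure := by
  constructor
  simp only [signMeasure, Measure.smul_apply, Measure.add_apply, measure_univ, smul_eq_mul]
  rw [one_add_one_eq_two, ENNReal.inv_mul_cancel (by norm_num) (by norm_num)]

lemma int_sign (G : ℝ → ℝ) : ∫ x, G x ∂signMeasure = (G (-1) + G 1) / 2 := by
  unfold signMeasure
  rw [integral_smul_measure, integral_add_measure (integrable_dirac (by simp))
    (integrable_dirac (by simp)), integral_dirac, integral_dirac]
  simp; ring

lemma int_chan {F : ℝ × ℝ → ℝ} (hF : BM F) :
    ∫ q, F q ∂(signMeasure.prod P) = ((∫ z, F (-1, z) ∂P) + ∫ z, F (1, z) ∂P) / 2 := by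
  rw [integral_prod _ (hF.integrable _), int_sign]

lemma int_neg {l : Measure ℝ} (hl : SymM l) (G : ℝ → ℝ) : ∫ y, G (-y) ∂l = ∫ y, G y ∂l := by
  conv_rhs => rw [← hl]
  exact ((MeasurableEquiv.neg ℝ).measurableEmbedding.integral_map (μ := l) G).symm

variable {P}
variable {τ : ℝ → ℝ} {l : Measure ℝ} [IsProbabilityMeasure l]

lemma chan1 (hτ : Soft τ) (hl : SymM l) (hP : P = tilt τ l) {G : ℝ → ℝ} (hG : BM G) :
    ∫ q : ℝ × ℝ, G (q.1 * q.2) ∂(signMeasure.prod P) = ∫ y, G y ∂l := by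
  rw [int_chan P (hG.comp (by fun_prop))]
  simp only [neg_mul, one_mul]
  rw [hP, integral_tilt hτ, integral_tilt hτ, ← int_neg hl (fun y => (1 + τ y) * G (-y))]
  simp only [neg_neg, hτ.odd]
  rw [← integral_add ((((BM.const 1).add hτ.bm.neg).mul hG).integrable _)
    ((((BM.const 1).add hτ.bm).mul hG).integrable _), ← integral_div]
  refine integral_congr_ae (Filter.Eventually.of_forall fun y => ?_)
  simp only; ring

lemma chan2 (hτ : Soft τ) (hl : SymM l) (hP : P = tilt τ l) {G : ℝ → ℝ} (hG : BM G) :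
    ∫ q : ℝ × ℝ, q.1 * G (q.1 * q.2) ∂(signMeasure.prod P) = ∫ y, τ y * G y ∂l := by
  have hae : ∀ᵐ q : ℝ × ℝ ∂(signMeasure.prod P), q.1 * G (q.1 * q.2)
      = max (-1) (min 1 q.1) * G (q.1 * q.2) := by
    have h1 : ∀ᵐ x ∂signMeasure, x = -1 ∨ x = 1 := by
      rw [ae_iff]
      have hm : MeasurableSet {x : ℝ | ¬ (x = -1 ∨ x = 1)} := by measurability
      simp [signMeasure]
    have h2 : ∀ᵐ q : ℝ × ℝ ∂(signMeasure.prod P), q.1 = -1 ∨ q.1 = 1 :=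
      Measure.quasiMeasurePreserving_fst.ae h1
    filter_upwards [h2] with q hq
    rcases hq with h | h <;> rw [h] <;> norm_num
  rw [integral_congr_ae hae, int_chan P (F := fun q => max (-1) (min 1 q.1) * G (q.1 * q.2))]
  · simp only [neg_mul, one_mul, min_self]
    rw [hP, integral_tilt hτ, integral_tilt hτ,
      ← int_neg hl (fun y => (1 + τ y) * (max (-1) (min 1 (-1)) * G (-y)))]
    simp only [neg_neg, hτ.odd]
    rw [← integral_add ((((BM.const 1).add hτ.bm.neg).mul ((BM.const _).mul hG)).integrable _)
      ((((BM.const 1).add hτ.bm).mul ((BM.const _).mul hG)).integrable _), ← integral_div]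
    refine integral_congr_ae (Filter.Eventually.of_forall fun y => ?_)
    simp only
    rw [min_eq_right (by norm_num), max_eq_left (by norm_num), max_eq_right (by norm_num)]
    ring
  · refine BM.mul ⟨by fun_prop, 1, fun q => ?_⟩ (hG.comp (by fun_prop))
    rw [abs_le]
    exact ⟨le_max_left _ _, max_le (by norm_num) (min_le_left _ _)⟩

lemma sign_int : Integrable (fun q : ℝ × ℝ => q.1) (signMeasure.prod P) := by
  have : Integrable (fun x : ℝ => x) signMeasure := by
    unfold signMeasure
    refine Integrable.smul_measure (Integrable.add_measure ?_ ?_) (by simp)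
    · exact integrable_dirac (by simp)
    · exact integrable_dirac (by simp)
  exact this.comp_fst P

lemma chan_cond (hτ : Soft τ) (hl : SymM l) (hP : P = tilt τ l) :
    (fun q : ℝ × ℝ => τ (q.1 * q.2)) =ᵐ[signMeasure.prod P]
      condMean (signMeasure.prod P) (fun q : ℝ × ℝ => q.1) (fun q : ℝ × ℝ => q.1 * q.2) := by
  unfold condMean
  have hW : Measurable (fun q : ℝ × ℝ => q.1 * q.2) := by fun_prop
  have hb : BM (fun q : ℝ × ℝ => τ (q.1 * q.2)) := hτ.bm.comp hW
  refine ae_eq_condExp_of_forall_setIntegral_eq hW.comap_le sign_int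
    (fun s _ _ => (hb.integrable _).integrableOn) ?_ ?_
  · rintro _ ⟨B, hB, rfl⟩ _
    have hI : BM (B.indicator fun _ => (1 : ℝ)) := by
      refine ⟨measurable_const.indicator hB, 1, fun y => ?_⟩
      by_cases h : y ∈ B <;> simp [h]
    rw [← integral_indicator (hW hB), ← integral_indicator (hW hB)]
    have e1 : ∀ F : ℝ × ℝ → ℝ, (Set.preimage (fun q : ℝ × ℝ => q.1 * q.2) B).indicator F
        = fun q => F q * (B.indicator fun _ => (1 : ℝ)) (q.1 * q.2) := by
      intro F
      funext q
      by_cases h : q.1 * q.2 ∈ B <;> simp [Set.indicator, h]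
    rw [e1, e1, chan2 hτ hl hP hI, chan1 hτ hl hP (hτ.bm.mul hI)]
  · have : Measurable[MeasurableSpace.comap (fun q : ℝ × ℝ => q.1 * q.2) inferInstance]
        (fun q : ℝ × ℝ => τ (q.1 * q.2)) := hτ.meas.comp (comap_measurable _)
    exact this.stronglyMeasurable.aestronglyMeasurable

lemma hb_eta {x : ℝ} : hb ((1 + x) / 2) = 1 - (eta x + eta (-x)) / (2 * Real.log 2) := by
  have hl2 : Real.log 2 ≠ 0 := (Real.log_pos (by norm_num)).ne'
  have key : ∀ u : ℝ, u / 2 * Real.logb 2 (u / 2) = (u * Real.log u - u * Real.log 2) / (2 * Real.log 2) := by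
    intro u
    by_cases hu : u = 0
    · simp [hu]
    · rw [Real.logb, Real.log_div hu (by norm_num)]
      field_simp
  unfold hb eta
  rw [show 1 - (1 + x) / 2 = (1 + -x) / 2 by ring, key, key]
  field_simp
  ring

lemma cap_eq (hτ : Soft τ) (hl : SymM l) (hP : P = tilt τ l) :
    ∫ y, eta (τ y) ∂l = capacity P * Real.log 2 := by
  have hl2 : Real.log 2 ≠ 0 := (Real.log_pos (by norm_num)).ne'
  have hb1 : BM (fun y => eta (τ y)) := hτ.bm.cont eta_cont
  have hb2 : BM (fun y => eta (-τ y)) := hτ.bm.neg.cont eta_cont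
  have hG : BM (fun y => hb ((1 + τ y) / 2)) := by
    simp only [hb_eta]
    simp only [div_eq_mul_inv]
    exact (BM.const 1).sub ((hb1.add hb2).mul (BM.const _))
  have h1 : ∫ p, hb ((1 + condMean (signMeasure.prod P)
        (fun q : ℝ × ℝ => q.1) (fun q : ℝ × ℝ => q.1 * q.2) p) / 2) ∂(signMeasure.prod P)
      = ∫ y, hb ((1 + τ y) / 2) ∂l := by
    rw [← chan1 hτ hl hP hG]
    refine integral_congr_ae ?_
    filter_upwards [chan_cond hτ hl hP] with q hq
    rw [← hq]
  have h2 : ∫ y, eta (-τ y) ∂l = ∫ y, eta (τ y) ∂l := by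
    rw [← int_neg hl (fun y => eta (τ y))]
    simp only [hτ.odd]
  unfold capacity
  rw [h1]
  simp only [hb_eta]
  simp only [div_eq_mul_inv]
  rw [integral_sub (integrable_const _) (((hb1.add hb2).mul (BM.const _)).integrable _),
    integral_mul_const, integral_add (hb1.integrable _) (hb2.integrable _), h2]
  simp
  field_simp
  ring

end channel

/-! ### Optimality of the conditional mean -/

lemma opt_le {Ω : Type*} {mW mΩ : MeasurableSpace Ω} (hle : mW ≤ mΩ) (μ : Measure Ω)
    [IsProbabilityMeasure μ] {X g : Ω → ℝ} (hX : Measurable X)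
    (hX1 : ∀ᵐ ω ∂μ, |X ω| ≤ 1) (hgs : StronglyMeasurable[mW] g) {C : ℝ}
    (hgC : ∀ ω, |g ω| ≤ C) :
    ∫ ω, (X ω - (μ[X | mW]) ω) ^ 2 ∂μ ≤ ∫ ω, (X ω - g ω) ^ 2 ∂μ := by
  set E := μ[X | mW] with hE
  have hE1 : ∀ᵐ ω ∂μ, |E ω| ≤ 1 := ae_bdd_abs_condExp_of_ae_bdd_abs hX1
  have hEs : StronglyMeasurable[mW] E := stronglyMeasurable_condExp
  have hEm : Measurable E := (hEs.mono hle).measurable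
  have hXi : Integrable X μ := Integrable.of_bound hX.aestronglyMeasurable 1 hX1
  have hEi : Integrable E μ := integrable_condExp
  set D : Ω → ℝ := fun ω => E ω - g ω with hD
  have hDs : StronglyMeasurable[mW] D := hEs.sub hgs
  have hDm : Measurable D := (hDs.mono hle).measurable
  have hDb : ∀ᵐ ω ∂μ, ‖D ω‖ ≤ 1 + C := by
    filter_upwards [hE1] with ω h
    exact (norm_sub_le _ _).trans (add_le_add h (hgC _))
  have hXD : Integrable (fun ω => X ω * D ω) μ :=
    hXi.mul_bdd (c := 1 + C) hDm.aestronglyMeasurable hDb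
  have hED : Integrable (fun ω => E ω * D ω) μ :=
    hEi.mul_bdd (c := 1 + C) hDm.aestronglyMeasurable hDb
  have hDi : Integrable D μ := Integrable.of_bound hDm.aestronglyMeasurable _ hDb
  have hDD : Integrable (fun ω => D ω * D ω) μ :=
    hDi.mul_bdd (c := 1 + C) hDm.aestronglyMeasurable hDb
  have hzero : ∫ ω, X ω * D ω ∂μ = ∫ ω, E ω * D ω ∂μ := by
    have h := condExp_mul_of_stronglyMeasurable_right (μ := μ) (f := X) (g := D) hDs hXD hXi
    have h2 := integral_condExp (μ := μ) (f := X * D) hle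
    rw [integral_congr_ae h] at h2
    exact h2.symm
  have hXE : Integrable (fun ω => (X ω - E ω) ^ 2) μ := by
    refine Integrable.of_bound (by fun_prop) 4 ?_
    filter_upwards [hX1, hE1] with ω h1 h2
    rw [Real.norm_eq_abs, abs_of_nonneg (sq_nonneg _)]
    have := abs_le.mp h1
    have := abs_le.mp h2
    nlinarith
  have e : ∀ ω, (X ω - g ω) ^ 2
      = (X ω - E ω) ^ 2 + ((2 * (X ω * D ω) - 2 * (E ω * D ω)) + D ω * D ω) := by
    intro ω; simp only [hD]; ring
  simp only [e]
  have i1 : Integrable (fun ω => 2 * (X ω * D ω)) μ := hXD.const_mul 2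
  have i2 : Integrable (fun ω => 2 * (E ω * D ω)) μ := hED.const_mul 2
  have i3 : Integrable (fun ω => 2 * (X ω * D ω) - 2 * (E ω * D ω)) μ := i1.sub i2
  have i4 : Integrable (fun ω => 2 * (X ω * D ω) - 2 * (E ω * D ω) + D ω * D ω) μ := i3.add hDD
  rw [integral_add hXE i4, integral_add i3 hDD, integral_sub i1 i2, integral_const_mul,
    integral_const_mul, hzero]
  have : 0 ≤ ∫ ω, D ω * D ω ∂μ := integral_nonneg fun ω => mul_self_nonneg _
  linarith

lemma mmse_le {Ω β : Type*} [MeasurableSpace Ω] [MeasurableSpace β] (μ : Measure Ω)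
    [IsProbabilityMeasure μ] {X : Ω → ℝ} {W : Ω → β} (hX : Measurable X) (hW : Measurable W)
    (hX1 : ∀ᵐ ω ∂μ, |X ω| ≤ 1) {g : β → ℝ} (hg : BM g) :
    mmse μ X W ≤ ∫ ω, (X ω - g (W ω)) ^ 2 ∂μ := by
  obtain ⟨hgm, C, hgC⟩ := hg
  refine opt_le hW.comap_le μ hX hX1 (g := fun ω => g (W ω)) ?_ fun ω => hgC _
  exact (hgm.comp (comap_measurable W)).stronglyMeasurable

section unif
variable {N : ℕ} {𝒞 : Finset (Fin N → ℝ)}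

lemma unif_prob (hC : SG 𝒞) : IsProbabilityMeasure (uniformOnFinset 𝒞) := by
  constructor
  have : 𝒞.card ≠ 0 := by have := hC.card_pos; intro h; simp [h] at this
  simp only [uniformOnFinset, Measure.smul_apply, Measure.finsetSum_apply, measure_univ,
    smul_eq_mul, Finset.sum_const, nsmul_eq_mul, mul_one]
  exact ENNReal.inv_mul_cancel (by exact_mod_cast this) (by simp)

lemma int_unif (G : (Fin N → ℝ) → ℝ) :
    ∫ x, G x ∂(uniformOnFinset 𝒞) = (𝒞.card : ℝ)⁻¹ * ∑ x ∈ 𝒞, G x := by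
  unfold uniformOnFinset
  rw [integral_smul_measure, integral_finsetSum_measure fun x _ => integrable_dirac (by simp)]
  simp

lemma ae_unif : ∀ᵐ x ∂(uniformOnFinset 𝒞), x ∈ 𝒞 := by
  rw [ae_iff]
  have hm : MeasurableSet {x | ¬ x ∈ 𝒞} := 𝒞.measurableSet.compl
  simp only [uniformOnFinset, Measure.smul_apply, Measure.finsetSum_apply, smul_eq_mul,
    mul_eq_zero]
  right
  refine Finset.sum_eq_zero fun x hx => ?_
  rw [Measure.dirac_apply' _ hm]
  simp [hx]

theorem mmse_code {Ω : Type*} [MeasurableSpace Ω] (μ : Measure Ω) [IsProbabilityMeasure μ]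
    (P : Measure ℝ) [IsProbabilityMeasure P] {τ : ℝ → ℝ} {l : Measure ℝ} [IsProbabilityMeasure l]
    (hτ : Soft τ) (hl : SymM l) (hP : P = tilt τ l) (hC : SG 𝒞)
    (X Z : Ω → (Fin N → ℝ)) (hX : Measurable X) (hZ : Measurable Z)
    (hlaw : Measure.map (fun ω => (X ω, Z ω)) μ
        = (uniformOnFinset 𝒞).prod (Measure.pi fun _ => P)) (i : Fin N) :
    mmse μ (fun ω => X ω i) (fun ω => fun j : {j : Fin N // j ≠ i} => X ω j.1 * Z ω j.1)
      ≤ 1 - ms τ 𝒞 l i (Finset.univ.erase i) := by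
  classical
  have hu := unif_prob hC
  set f := fd τ 𝒞 i (Finset.univ.erase i) with hf
  have hfb : BM f := fd_bm hτ hC i _
  have hXC : ∀ᵐ ω ∂μ, X ω ∈ 𝒞 := by
    have h1 : ∀ᵐ q ∂(Measure.map (fun ω => (X ω, Z ω)) μ), q.1 ∈ 𝒞 := by
      rw [hlaw]
      exact Measure.quasiMeasurePreserving_fst.ae ae_unif
    exact ae_of_ae_map (hX.prodMk hZ).aemeasurable h1
  let ext : ({j : Fin N // j ≠ i} → ℝ) → (Fin N → ℝ) :=
    fun w j => if h : j ≠ i then w ⟨j, h⟩ else 0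
  have hext : Measurable ext := by
    refine measurable_pi_lambda _ fun j => ?_
    by_cases h : j ≠ i
    · simp only [ext, h, dif_pos, ne_eq, not_false_eq_true]
      exact measurable_pi_apply _
    · simp only [ext, h, dif_neg, not_false_eq_true]
      exact measurable_const
  have hfe : ∀ ω, f (ext fun j : {j : Fin N // j ≠ i} => X ω j.1 * Z ω j.1)
      = f (act (X ω) (Z ω)) := by
    intro ω
    apply fd_dep i (Finset.univ.erase i)
    intro j hj
    have : j ≠ i := by simpa using hj
    simp [ext, this, act]
  have hle := mmse_le μ (X := fun ω => X ω i)
    (W := fun ω => fun j : {j : Fin N // j ≠ i} => X ω j.1 * Z ω j.1)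
    (by fun_prop) (by fun_prop) (by
      filter_upwards [hXC] with ω h
      rcases hC.pm _ h i with h' | h' <;> simp [h']) (g := fun w => f (ext w)) (hfb.comp hext)
  refine hle.trans (le_of_eq ?_)
  simp only [hfe]
  let F : (Fin N → ℝ) × (Fin N → ℝ) → ℝ :=
    fun q => (max (-1) (min 1 (q.1 i)) - f (act q.1 q.2)) ^ 2
  have hF : BM F := by
    refine BM.pow (BM.sub ⟨by fun_prop, 1, fun q => ?_⟩ (hfb.comp ?_)) 2
    · rw [abs_le]
      exact ⟨le_max_left _ _, max_le (by norm_num) (min_le_left _ _)⟩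
    · unfold act; fun_prop
  have hcl : ∀ x ∈ 𝒞, max (-1) (min 1 (x i)) = x i := by
    intro x hx
    rcases hC.pm x hx i with h | h <;> rw [h] <;> norm_num
  have e1 : ∫ ω, (X ω i - f (act (X ω) (Z ω))) ^ 2 ∂μ = ∫ ω, F (X ω, Z ω) ∂μ := by
    refine integral_congr_ae ?_
    filter_upwards [hXC] with ω h
    simp only [F, hcl _ h]
  rw [e1, ← integral_map (hX.prodMk hZ).aemeasurable hF.1.aestronglyMeasurable, hlaw,
    integral_prod _ (hF.integrable _), int_unif]
  have e2 : ∀ x ∈ 𝒞, ∫ z, F (x, z) ∂(Measure.pi fun _ => P)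
      = 1 - ms τ 𝒞 l i (Finset.univ.erase i) := by
    intro x hx
    have : ∀ z, F (x, z) = 1 - 2 * f z + f z ^ 2 := by
      intro z
      simp only [F, hcl x hx, hf, fd_act hτ hC hx]
      have := hC.sq hx i
      linear_combination (1 - fd τ 𝒞 i (Finset.univ.erase i) z) ^ 2 * this
    simp only [this]
    have hb2 : BM (fun z => 2 * f z) := (BM.const 2).mul hfb
    rw [integral_add (((BM.const 1).sub hb2).integrable _) ((hfb.pow 2).integrable _),
      integral_sub (integrable_const _) (hb2.integrable _), integral_const_mul, hP,
      int_f hτ hC hl, int_sq hτ hC hl]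
    have := tilt_prob hτ hl
    simp
    ring
  rw [Finset.sum_congr rfl e2, Finset.sum_const, nsmul_eq_mul, ← mul_assoc,
    inv_mul_cancel₀ hC.card_pos.ne', one_mul]

end unif

end RMB

/-- For an RM(r,m) code over a BMS channel with capacity `C ∈ (0,1)`, if
`R(r,m) < C` then for every coordinate `i`, the extrinsic MMSE satisfies
`mmse(X_i | Y_{∼i}) ≤ ρ(m)/(C − R(r,m))`. -/
theorem stmt_3
    {Ω : Type*} [MeasurableSpace Ω] (μ : Measure Ω) [IsProbabilityMeasure μ]
    (PZ : Measure ℝ) [IsProbabilityMeasure PZ]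
    (hC0 : 0 < capacity PZ) (hC1 : capacity PZ < 1)
    (r m : ℕ) (hrm : r ≤ m) (hm : 1 ≤ m)
    (X Z : Ω → (Fin (2 ^ m) → ℝ)) (hX : Measurable X) (hZ : Measurable Z)
    (hlaw : Measure.map (fun ω => (X ω, Z ω)) μ
        = (uniformOnFinset (bpskRM r m)).prod (Measure.pi fun _ => PZ))
    (hrate : RMrate r m < capacity PZ) :
    ∀ i : Fin (2 ^ m),
      mmse μ (fun ω => X ω i)
          (fun ω => fun j : {j : Fin (2 ^ m) // j ≠ i} => X ω j.1 * Z ω j.1)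
        ≤ rho m / (capacity PZ - RMrate r m) := by
  intro i
  obtain ⟨τ, hτ, hP⟩ := RMB.exists_tau PZ
  have hp := RMB.slam_prob PZ
  have hl := RMB.slam_sym PZ
  refine (RMB.mmse_code μ PZ hτ hl hP (RMB.RM_SG r m) X Z hX hZ hlaw i).trans ?_
  obtain ⟨n, rfl⟩ : ∃ n, m = n + 1 := ⟨m - 1, by omega⟩
  exact RMB.M_bound hτ hl i (RMB.cap_eq hτ hl hP) hrate
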